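/- arXiv:2010.11664 — 13 statements merged into one kernel-verified Lean document; each statement's English description precedes it below -/
import Mathlib

section
/- Let H be a finite oriented graph with the property that every two non-adjacent vertices of H have the same out-neighborhood and the same in-neighborhood. Then for every natural number n there exists an oriented graph G on n vertices with the same property (every two non-adjacent vertices of G have the same out-neighborhood and the same in-neighborhood) such that N(H,G) = max{N(H,G') : G' an oriented graph on n vertices}. -/
/-- The number of induced copies of a `k`-vertex oriented graph `H` in an oriented
graph `G` on vertex set `V`: the number of `k`-element subsets of `V` admitting a
bijection from the vertices of `H` mapping arcs to arcs and non-arcs to non-arcs. -/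
noncomputable def inducedCopies {k : ℕ} (H : Fin k → Fin k → Prop) {V : Type} [Fintype V] [DecidableEq V]
    (G : V → V → Prop) : ℕ :=
  Set.ncard {S : Finset V | ∃ f : Fin k → V, Function.Injective f ∧
    Finset.univ.image f = S ∧ ∀ i j, H i j ↔ G (f i) (f j)}

/-- Every two non-adjacent vertices have the same out-neighborhood and the same
in-neighborhood. -/
def SameNbhdOfNonAdj {V : Type} (G : V → V → Prop) : Prop :=
  ∀ v w : V, v ≠ w → ¬ G v w → ¬ G w v →
    (∀ u, G v u ↔ G w u) ∧ (∀ u, G u v ↔ G u w)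

/-- A `k`-set `S` spans an induced copy of `H` in `G`. -/
def IsInducedCopy {k : ℕ} (H : Fin k → Fin k → Prop) {V : Type} [DecidableEq V]
    (G : V → V → Prop) (S : Finset V) : Prop :=
  ∃ f : Fin k → V, Function.Injective f ∧
    Finset.univ.image f = S ∧ ∀ i j, H i j ↔ G (f i) (f j)

/-- `x` and `y` have the same out-neighborhood and the same in-neighborhood. -/
def Twin {V : Type} (G : V → V → Prop) (x y : V) : Prop :=
  (∀ u, G x u ↔ G y u) ∧ (∀ u, G u x ↔ G u y)

/-- The relation obtained from `G` by turning `w` into a clone of `v`. -/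
def cloneVertex {V : Type} [DecidableEq V] (G : V → V → Prop) (v w : V) : V → V → Prop :=
  fun x y => G (if x = w then v else x) (if y = w then v else y)

open Classical in
/-- The number of ordered pairs of twins. -/
noncomputable def twinPairs {V : Type} [Fintype V] (G : V → V → Prop) : ℕ :=
  ∑ x, ∑ y, if Twin G x y then 1 else 0

theorem Twin.symm {V : Type} {G : V → V → Prop} {x y : V} (h : Twin G x y) : Twin G y x :=
  ⟨fun u => (h.1 u).symm, fun u => (h.2 u).symm⟩

theorem Twin.trans {V : Type} {G : V → V → Prop} {x y z : V} (h : Twin G x y)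
    (h' : Twin G y z) : Twin G x z :=
  ⟨fun u => (h.1 u).trans (h'.1 u), fun u => (h.2 u).trans (h'.2 u)⟩

theorem twin_cloneVertex_self {V : Type} [DecidableEq V] (G : V → V → Prop) (v w : V) :
    Twin (cloneVertex G v w) w v := by
  constructor <;> intro u <;> by_cases h : v = w <;> simp [cloneVertex, h]

theorem Twin.cloneVertex {V : Type} [DecidableEq V] {G : V → V → Prop} {v w x y : V}
    (h : Twin G x y) (hx : x ≠ w) (hy : y ≠ w) : Twin (cloneVertex G v w) x y := by
  constructor <;> intro u <;> simp only [_root_.cloneVertex, hx, hy, if_false]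
  · exact h.1 _
  · exact h.2 _

theorem sum_sum_eq_of_symm {V : Type} [Fintype V] [DecidableEq V] (t : V → V → ℕ)
    (ht : ∀ x y, t x y = t y x) (w : V) :
    ∑ x, ∑ y, t x y = t w w + 2 * ∑ y ∈ Finset.univ.erase w, t w y +
      ∑ x ∈ Finset.univ.erase w, ∑ y ∈ Finset.univ.erase w, t x y := by
  have split (g : V → ℕ) : ∑ x, g x = g w + ∑ x ∈ Finset.univ.erase w, g x :=
    (Finset.add_sum_erase _ _ (Finset.mem_univ w)).symm
  rw [split, split (t w), Finset.sum_congr rfl fun x _ => split (t x), Finset.sum_add_distrib,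
    Finset.sum_congr rfl fun x _ => ht x w]
  ring

open Classical in
/-- Cloning into an at least as large twin class creates twin pairs. -/
theorem twinPairs_lt_cloneVertex {V : Type} [Fintype V] [DecidableEq V] {G : V → V → Prop}
    {v w : V} (hvw : ¬ Twin G v w)
    (hle : ∑ y, (if Twin G w y then 1 else 0) ≤ ∑ y, (if Twin G v y then 1 else 0)) :
    twinPairs G < twinPairs (cloneVertex G v w) := by
  have comm (G : V → V → Prop) (x y : V) :
      (if Twin G x y then 1 else 0) = (if Twin G y x then 1 else 0) :=
    if_congr ⟨Twin.symm, Twin.symm⟩ rfl rfl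
  have hne : v ≠ w := by
    rintro rfl
    exact hvw ⟨fun _ => Iff.rfl, fun _ => Iff.rfl⟩
  have refl (G : V → V → Prop) (x : V) : Twin G x x := ⟨fun _ => Iff.rfl, fun _ => Iff.rfl⟩
  unfold twinPairs
  rw [sum_sum_eq_of_symm _ (comm G) w, sum_sum_eq_of_symm _ (comm (cloneVertex G v w)) w]
  rw [← Finset.add_sum_erase _ _ (Finset.mem_univ w),
    ← Finset.add_sum_erase _ (fun y => if Twin G v y then 1 else 0) (Finset.mem_univ w)] at hle
  have hrow : ∑ y ∈ Finset.univ.erase w, (if Twin G v y then 1 else 0) ≤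
      ∑ y ∈ Finset.univ.erase w, (if Twin (cloneVertex G v w) w y then 1 else 0) := by
    refine Finset.sum_le_sum fun y hy => ?_
    by_cases h : Twin G v y
    · rw [if_pos h, if_pos ((twin_cloneVertex_self G v w).trans
        (h.cloneVertex hne (Finset.ne_of_mem_erase hy)))]
    · simp [h]
  have hrest : ∑ x ∈ Finset.univ.erase w, ∑ y ∈ Finset.univ.erase w,
      (if Twin G x y then 1 else 0) ≤ ∑ x ∈ Finset.univ.erase w, ∑ y ∈ Finset.univ.erase w,
      (if Twin (cloneVertex G v w) x y then 1 else 0) := by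
    refine Finset.sum_le_sum fun x hx => Finset.sum_le_sum fun y hy => ?_
    by_cases h : Twin G x y
    · rw [if_pos h, if_pos (h.cloneVertex (Finset.ne_of_mem_erase hx)
        (Finset.ne_of_mem_erase hy))]
    · simp [h]
  simp only [if_pos (refl _ w), if_neg hvw] at hle ⊢
  omega

theorem IsInducedCopy.cloneVertex {k : ℕ} {H : Fin k → Fin k → Prop}
    (hH : SameNbhdOfNonAdj H) {V : Type} [DecidableEq V] {G : V → V → Prop}
    {v w : V} (hvw : ¬ G v w) (hwv : ¬ G w v)
    {S : Finset V} (hS : IsInducedCopy H G S) (hmem : w ∈ S → v ∈ S) :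
    IsInducedCopy H (cloneVertex G v w) S := by
  obtain ⟨f, hf, rfl, hHG⟩ := hS
  refine ⟨f, hf, rfl, fun i j => (hHG i j).trans ?_⟩
  by_cases hw : w ∈ Finset.univ.image f
  · obtain ⟨a, -, rfl⟩ := Finset.mem_image.1 (hmem hw)
    obtain ⟨b, -, rfl⟩ := Finset.mem_image.1 hw
    have key : Twin H a b := by
      by_cases hab : a = b
      · subst hab
        exact ⟨fun _ => Iff.rfl, fun _ => Iff.rfl⟩
      · exact hH a b hab (by rwa [hHG]) (by rwa [hHG])
    have hout (j) : G (f b) (f j) ↔ G (f a) (f j) := by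
      rw [← hHG, ← hHG]; exact (key.1 j).symm
    have hin (j) : G (f j) (f b) ↔ G (f j) (f a) := by
      rw [← hHG, ← hHG]; exact (key.2 j).symm
    by_cases hi : f i = f b <;> by_cases hj : f j = f b <;>
      simp [_root_.cloneVertex, hi, hj, hout, hin]
  · have hne (i) : f i ≠ w := fun h => hw (h ▸ Finset.mem_image_of_mem f (Finset.mem_univ i))
    simp [_root_.cloneVertex, hne]

theorem IsInducedCopy.map_swap_cloneVertex {k : ℕ} {H : Fin k → Fin k → Prop} {V : Type}
    [DecidableEq V] {G : V → V → Prop} {v w : V} {S : Finset V}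
    (hS : IsInducedCopy H G S) (hw : w ∉ S) :
    IsInducedCopy H (_root_.cloneVertex G v w) (S.map (Equiv.swap v w).toEmbedding) := by
  obtain ⟨f, hf, rfl, hHG⟩ := hS
  refine ⟨Equiv.swap v w ∘ f, (Equiv.swap v w).injective.comp hf, ?_, fun i j => ?_⟩
  · rw [Finset.map_eq_image, Finset.image_image]
    rfl
  · have hσ (i) : (if Equiv.swap v w (f i) = w then v else Equiv.swap v w (f i)) = f i := by
      have hne : f i ≠ w := fun h => hw (h ▸ Finset.mem_image_of_mem f (Finset.mem_univ i))
      by_cases hv : f i = v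
      · simp [hv]
      · rw [Equiv.swap_apply_of_ne_of_ne hv hne, if_neg hne]
    simp only [_root_.cloneVertex, Function.comp_apply, hσ]
    exact hHG i j

open Classical in
theorem inducedCopies_eq_card {k : ℕ} (H : Fin k → Fin k → Prop) {V : Type} [Fintype V]
    [DecidableEq V] (G : V → V → Prop) :
    inducedCopies H G = (Finset.univ.filter (IsInducedCopy H G)).card := by
  rw [← Set.ncard_coe_finset]
  simp [inducedCopies, IsInducedCopy]

open Classical in
/-- The number of copies gained and lost by cloning is controlled by the copies that contain
exactly one of the two vertices. -/
theorem inducedCopies_add_le_cloneVertex {k : ℕ} {H : Fin k → Fin k → Prop}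
    (hH : SameNbhdOfNonAdj H) {V : Type} [Fintype V] [DecidableEq V] {G : V → V → Prop}
    {v w : V} (hvw : ¬ G v w) (hwv : ¬ G w v) :
    inducedCopies H G +
        (Finset.univ.filter fun S => IsInducedCopy H G S ∧ v ∈ S ∧ w ∉ S).card ≤
      inducedCopies H (cloneVertex G v w) +
        (Finset.univ.filter fun S => IsInducedCopy H G S ∧ w ∈ S ∧ v ∉ S).card := by
  set A := Finset.univ.filter fun S => IsInducedCopy H G S ∧ (w ∈ S → v ∈ S)
  set B := Finset.univ.filter fun S => IsInducedCopy H G S ∧ v ∈ S ∧ w ∉ S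
  set C := Finset.univ.filter fun S => IsInducedCopy H G S ∧ w ∈ S ∧ v ∉ S with hC
  have hsplit : inducedCopies H G = A.card + C.card := by
    rw [inducedCopies_eq_card,
      ← Finset.card_filter_add_card_filter_not (p := fun S : Finset V => w ∈ S → v ∈ S),
      Finset.filter_filter, Finset.filter_filter]
    congr 2
    ext S
    simp [hC]
  set B' := B.image fun S => S.map (Equiv.swap v w).toEmbedding
  have hcard : B'.card = B.card :=
    Finset.card_image_of_injective _ (Finset.map_injective _)
  have hdisj : Disjoint A B' := by
    rw [Finset.disjoint_left]
    intro S hSA hSB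
    obtain ⟨T, hT, rfl⟩ := Finset.mem_image.1 hSB
    obtain ⟨-, hv, hw⟩ := (Finset.mem_filter.1 hT).2
    have := (Finset.mem_filter.1 hSA).2.2
    simp only [Finset.mem_map_equiv, Equiv.symm_swap, Equiv.swap_apply_left,
      Equiv.swap_apply_right] at this
    exact hw (this hv)
  have hsub : A ∪ B' ⊆ Finset.univ.filter (IsInducedCopy H (cloneVertex G v w)) := by
    refine Finset.union_subset (fun S hS => ?_) fun S hS => ?_
    · obtain ⟨h, hm⟩ := (Finset.mem_filter.1 hS).2
      exact Finset.mem_filter.2 ⟨Finset.mem_univ _, h.cloneVertex hH hvw hwv hm⟩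
    · obtain ⟨T, hT, rfl⟩ := Finset.mem_image.1 hS
      obtain ⟨h, -, hw⟩ := (Finset.mem_filter.1 hT).2
      exact Finset.mem_filter.2 ⟨Finset.mem_univ _, h.map_swap_cloneVertex hw⟩
  have := Finset.card_le_card hsub
  rw [Finset.card_union_of_disjoint hdisj, hcard, ← inducedCopies_eq_card] at this
  omega

theorem stmt0 {k : ℕ} (H : Fin k → Fin k → Prop)
    (hHasymm : ∀ u v, ¬ (H u v ∧ H v u)) (hHprop : SameNbhdOfNonAdj H) (n : ℕ) :
    ∃ G : Fin n → Fin n → Prop, (∀ u v, ¬ (G u v ∧ G v u)) ∧ SameNbhdOfNonAdj G ∧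
      inducedCopies H G =
        sSup {m : ℕ | ∃ G' : Fin n → Fin n → Prop,
          (∀ u v, ¬ (G' u v ∧ G' v u)) ∧ m = inducedCopies H G'} := by
  classical
  have hne : Set.Nonempty {G : Fin n → Fin n → Prop | ∀ u v, ¬ (G u v ∧ G v u)} :=
    ⟨fun _ _ => False, by simp⟩
  obtain ⟨G₀, hG₀, hmax₀⟩ := Set.exists_max_image _ (inducedCopies H) (Set.toFinite _) hne
  obtain ⟨G, ⟨hG, hmax⟩, htwin⟩ := Set.exists_max_image
    {G : Fin n → Fin n → Prop | (∀ u v, ¬ (G u v ∧ G v u)) ∧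
      ∀ G' : Fin n → Fin n → Prop, (∀ u v, ¬ (G' u v ∧ G' v u)) →
        inducedCopies H G' ≤ inducedCopies H G}
    twinPairs (Set.toFinite _) ⟨G₀, hG₀, hmax₀⟩
  refine ⟨G, hG, ?_, ?_⟩
  · intro v w _ hvw hwv
    by_contra hnot
    change ¬ Twin G v w at hnot
    have hclone (x y : Fin n) : ∀ a b, ¬ (cloneVertex G x y a b ∧ cloneVertex G x y b a) :=
      fun a b => hG _ _
    have h₁ := inducedCopies_add_le_cloneVertex hHprop hvw hwv
    have h₂ := inducedCopies_add_le_cloneVertex hHprop hwv hvw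
    have m₁ := hmax _ (hclone v w)
    have m₂ := hmax _ (hclone w v)
    rcases le_total (∑ y, (if Twin G w y then 1 else 0)) (∑ y, (if Twin G v y then 1 else 0))
      with hle | hle
    · refine (twinPairs_lt_cloneVertex hnot hle).not_ge (htwin _ ⟨hclone v w, fun G' hG' => ?_⟩)
      exact (hmax G' hG').trans (by omega)
    · refine (twinPairs_lt_cloneVertex (fun h => hnot h.symm) hle).not_ge
        (htwin _ ⟨hclone w v, fun G' hG' => ?_⟩)
      exact (hmax G' hG').trans (by omega)
  · symm
    apply IsGreatest.csSup_eq
    refine ⟨⟨G, hG, rfl⟩, ?_⟩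
    rintro m ⟨G', hG', rfl⟩
    exact hmax G' hG'
end

section
/- For every oriented graph G on n vertices, the number of induced copies of H31 in G satisfies N(H31, G) ≤ max{ C(t,2)·C(n−t,2) : 0 ≤ t ≤ n }, where C(a,2) denotes the binomial coefficient a choose 2. -/
/-- The oriented graph on 4 vertices with arcs 1→2, 1→3, 1→4, 2→3, 2→4
(vertices 3 and 4 non-adjacent), here on `Fin 4` as 0→1, 0→2, 0→3, 1→2, 1→3. -/
def H31 : Fin 4 → Fin 4 → Prop := fun i j =>
  (i = 0 ∧ j = 1) ∨ (i = 0 ∧ j = 2) ∨ (i = 0 ∧ j = 3) ∨ (i = 1 ∧ j = 2) ∨ (i = 1 ∧ j = 3)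

open Finset

/-- Twice the weighted number of copies of `H31` in the blow-up of `G` in which each vertex `v`
is replaced by an independent set of size `w v`. -/
noncomputable def blowupCount {V : Type} [Fintype V] [DecidableEq V] (G : V → V → Prop) (w : V → ℤ) : ℤ :=
  open Classical in
  ∑ a, ∑ b, if G a b then w a * w b * ∑ x, ∑ y,
    (if G a x ∧ G b x ∧ G a y ∧ G b y ∧ ¬ G x y ∧ ¬ G y x then
      w x * (w y - if x = y then 1 else 0) else 0) else 0

theorem exists_quadratic_sum {ι : Type} (s : Finset ι) (f : ι → ℤ → ℤ)
    (h : ∀ i ∈ s, ∃ L R : ℤ, 0 ≤ R ∧ ∀ t, f i t = f i 0 + t * L + t ^ 2 * R) :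
    ∃ L R : ℤ, 0 ≤ R ∧ ∀ t, ∑ i ∈ s, f i t = ∑ i ∈ s, f i 0 + t * L + t ^ 2 * R := by
  choose! L R hR hf using h
  refine ⟨∑ i ∈ s, L i, ∑ i ∈ s, R i, sum_nonneg hR, fun t => ?_⟩
  rw [mul_sum, mul_sum, ← sum_add_distrib, ← sum_add_distrib]
  exact sum_congr rfl fun i hi => hf i hi t

theorem exists_quadratic_form {V : Type} [Fintype V] (m k : V → V → ℤ) (w u : V → ℤ) :
    ∃ L : ℤ, ∀ t : ℤ, ∑ x, ∑ y, m x y * ((w x + t * u x) * (w y + t * u y - k x y)) =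
      ∑ x, ∑ y, m x y * (w x * (w y - k x y)) + t * L
        + t ^ 2 * ∑ x, ∑ y, m x y * (u x * u y) := by
  refine ⟨∑ x, ∑ y, m x y * (u x * (w y - k x y) + w x * u y), fun t => ?_⟩
  simp only [mul_sum, ← sum_add_distrib]
  exact sum_congr rfl fun x _ => sum_congr rfl fun y _ => by ring

theorem sum_sum_mul_single_sub_single {V : Type} [Fintype V] [DecidableEq V]
    (m : V → V → ℤ) (c d : V) :
    ∑ x, ∑ y, m x y * ((Pi.single c 1 - Pi.single d 1 : V → ℤ) x *
      (Pi.single c 1 - Pi.single d 1 : V → ℤ) y) = m c c - m c d - m d c + m d d := by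
  simp only [Pi.sub_apply, Pi.single_apply, mul_sub, sub_mul, sum_sub_distrib]
  simp
  ring

/-- Along the direction that moves weight between two nonadjacent vertices, `blowupCount` is a
convex quadratic polynomial. -/
theorem blowupCount_quadratic {V : Type} [Fintype V] [DecidableEq V] {G : V → V → Prop}
    (hG : ∀ u v, ¬ (G u v ∧ G v u)) {w : V → ℤ} (hw : ∀ v, 0 ≤ w v) {c d : V}
    (hcd : ¬ G c d) (hdc : ¬ G d c) :
    ∃ L R : ℤ, 0 ≤ R ∧ ∀ t : ℤ,
      blowupCount G (fun v => w v + t * (Pi.single c 1 - Pi.single d 1 : V → ℤ) v) =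
        blowupCount G w + t * L + t ^ 2 * R := by
  classical
  have irr : ∀ v, ¬ G v v := fun v h => hG v v ⟨h, h⟩
  have hu : ∀ v, v ≠ c → v ≠ d → (Pi.single c 1 - Pi.single d 1 : V → ℤ) v = 0 := by
    intro v h1 h2
    simp [h1, h2]
  have hadj : ∀ a x, (a = c ∨ a = d) → (G a x ∨ G x a) →
      (Pi.single c 1 - Pi.single d 1 : V → ℤ) x = 0 := by
    rintro a x ha h
    apply hu x
    · rintro rfl; rcases ha with rfl | rfl <;> simp_all
    · rintro rfl; rcases ha with rfl | rfl <;> simp_all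
  have hform := fun a b => exists_quadratic_form
    (fun x y => if G a x ∧ G b x ∧ G a y ∧ G b y ∧ ¬ G x y ∧ ¬ G y x then 1 else 0)
    (fun x y => if x = y then 1 else 0) w (Pi.single c 1 - Pi.single d 1)
  have hpos : ∀ a b, 0 ≤ ∑ x, ∑ y,
      (if G a x ∧ G b x ∧ G a y ∧ G b y ∧ ¬ G x y ∧ ¬ G y x then (1 : ℤ) else 0) *
        ((Pi.single c 1 - Pi.single d 1 : V → ℤ) x *
          (Pi.single c 1 - Pi.single d 1 : V → ℤ) y) := by
    intro a b
    rw [sum_sum_mul_single_sub_single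
      (fun x y => if G a x ∧ G b x ∧ G a y ∧ G b y ∧ ¬ G x y ∧ ¬ G y x then (1 : ℤ) else 0)]
    by_cases h1 : G a c <;> by_cases h2 : G b c <;> by_cases h3 : G a d <;>
      by_cases h4 : G b d <;> simp [h1, h2, h3, h4, irr, hcd, hdc]
  generalize (Pi.single c 1 - Pi.single d 1 : V → ℤ) = u at hu hadj hform hpos ⊢
  have key := exists_quadratic_sum (univ : Finset V) (fun a t => ∑ b, if G a b then
    (w a + t * u a) * (w b + t * u b) * ∑ x, ∑ y,
    (if G a x ∧ G b x ∧ G a y ∧ G b y ∧ ¬ G x y ∧ ¬ G y x then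
      (w x + t * u x) * (w y + t * u y - if x = y then 1 else 0) else 0) else 0) ?_
  · simpa [blowupCount] using key
  intro a _
  refine exists_quadratic_sum univ (fun b t => if G a b then
    (w a + t * u a) * (w b + t * u b) * ∑ x, ∑ y,
    (if G a x ∧ G b x ∧ G a y ∧ G b y ∧ ¬ G x y ∧ ¬ G y x then
      (w x + t * u x) * (w y + t * u y - if x = y then 1 else 0) else 0) else 0) ?_
  intro b _
  by_cases hab : G a b
  swap
  · exact ⟨0, 0, le_rfl, by simp [hab]⟩
  by_cases hab' : (a = c ∨ a = d) ∨ (b = c ∨ b = d)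
  · have hfree : ∀ x, G a x ∧ G b x → u x = 0 := by
      rintro x ⟨h1, h2⟩
      rcases hab' with h | h
      · exact hadj a x h (.inl h1)
      · exact hadj b x h (.inl h2)
    have hprod : u a * u b = 0 := by
      rcases hab' with h | h
      · simp [hadj a b h (.inl hab)]
      · simp [hadj b a h (.inr hab)]
    refine ⟨(u a * w b + w a * u b) * ∑ x, ∑ y,
      (if G a x ∧ G b x ∧ G a y ∧ G b y ∧ ¬ G x y ∧ ¬ G y x then
        w x * (w y - if x = y then 1 else 0) else 0), 0, le_rfl, fun t => ?_⟩
    have hconst : ∀ t, (∑ x, ∑ y,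
        (if G a x ∧ G b x ∧ G a y ∧ G b y ∧ ¬ G x y ∧ ¬ G y x then
          (w x + t * u x) * (w y + t * u y - if x = y then 1 else 0) else 0)) = ∑ x, ∑ y,
        (if G a x ∧ G b x ∧ G a y ∧ G b y ∧ ¬ G x y ∧ ¬ G y x then
          w x * (w y - if x = y then 1 else 0) else 0) := by
      intro t
      refine sum_congr rfl fun x _ => sum_congr rfl fun y _ => ?_
      split_ifs with h <;> first | rfl | simp [hfree x ⟨h.1, h.2.1⟩, hfree y ⟨h.2.2.1, h.2.2.2.1⟩]
    simp only [hab, if_true, hconst]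
    linear_combination (t ^ 2 * ∑ x, ∑ y,
        (if G a x ∧ G b x ∧ G a y ∧ G b y ∧ ¬ G x y ∧ ¬ G y x then
          w x * (w y - if x = y then 1 else 0) else 0)) * hprod
  · push Not at hab'
    obtain ⟨L, hL⟩ := hform a b
    refine ⟨w a * w b * L, w a * w b * _,
      mul_nonneg (mul_nonneg (hw a) (hw b)) (hpos a b), fun t => ?_⟩
    have h0 := hL 0
    have ht := hL t
    simp only [ite_mul, one_mul, zero_mul] at h0 ht
    simp only [hab, if_true, hu a hab'.1.1 hab'.1.2, hu b hab'.2.1 hab'.2.2, mul_zero, add_zero,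
      zero_mul, ite_mul, one_mul, ht]
    ring

/-- The number of edges in a complete multipartite graph with the given part sizes. -/
def multipartiteEdges : List ℕ → ℤ
  | [] => 0
  | q :: l => multipartiteEdges l + q * l.sum

/-- Twice the number of copies of `H31` in the complete multipartite graph with the given part
sizes, where every part dominates the parts preceding it in the list. -/
def multipartiteCount : List ℕ → ℤ
  | [] => 0
  | q :: l => multipartiteCount l + q * (q - 1) * multipartiteEdges l

/-- Twice the number of nonadjacent pairs in a complete multipartite graph. -/
def multipartiteNonedges : List ℕ → ℤ
  | [] => 0
  | q :: l => multipartiteNonedges l + q * (q - 1)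

theorem natCast_mul_sub_one_nonneg (q : ℕ) : (0 : ℤ) ≤ q * (q - 1) := by
  rcases q with _ | q
  · simp
  · push_cast; nlinarith

theorem multipartiteNonedges_nonneg (l : List ℕ) : 0 ≤ multipartiteNonedges l := by
  induction l with
  | nil => simp [multipartiteNonedges]
  | cons q l ih => have := natCast_mul_sub_one_nonneg q; simp only [multipartiteNonedges]; linarith

theorem multipartiteEdges_replicate_one (j : ℕ) :
    2 * multipartiteEdges (List.replicate j 1) = j * (j - 1) := by
  induction j with
  | zero => simp [multipartiteEdges]
  | succ j ih => simp [multipartiteEdges, List.replicate_succ] at *; linarith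

theorem multipartiteCount_replicate_one (j : ℕ) :
    multipartiteCount (List.replicate j 1) = 0 := by
  induction j with
  | zero => simp [multipartiteCount]
  | succ j ih => simp [multipartiteCount, List.replicate_succ, ih]

theorem multipartiteEdges_append (l A B : List ℕ) (h : A.sum = B.sum) :
    multipartiteEdges (l ++ B) - multipartiteEdges (l ++ A)
      = multipartiteEdges B - multipartiteEdges A := by
  induction l with
  | nil => simp
  | cons q l ih =>
    simp only [List.cons_append, multipartiteEdges, List.sum_append, h]
    linarith

theorem multipartiteCount_append (l A B : List ℕ) (h : A.sum = B.sum) :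
    multipartiteCount (l ++ B) - multipartiteCount (l ++ A)
      = multipartiteCount B - multipartiteCount A
        + multipartiteNonedges l * (multipartiteEdges B - multipartiteEdges A) := by
  induction l with
  | nil => simp [multipartiteNonedges]
  | cons q l ih =>
    simp only [List.cons_append, multipartiteCount, multipartiteNonedges]
    linear_combination ih + q * (q - 1) * multipartiteEdges_append l A B h

theorem le_multipartiteEdges_append_replicate (l : List ℕ) (j : ℕ) :
    (j : ℤ) * (j - 1) + 2 * j * l.sum ≤ 2 * multipartiteEdges (l ++ List.replicate j 1) := by
  induction l with
  | nil => simp [multipartiteEdges_replicate_one]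
  | cons q l ih =>
    simp only [List.cons_append, multipartiteEdges, List.sum_append, List.sum_cons,
      List.sum_replicate, smul_eq_mul, mul_one, Nat.cast_add]
    have : (0 : ℤ) ≤ q * l.sum := by positivity
    linarith

theorem multipartiteCount_split (l : List ℕ) (x j : ℕ)
    (h : (j : ℤ) * (j - 1) ≤ multipartiteNonedges l) :
    multipartiteCount (l ++ [x] ++ List.replicate j 1) ≤
      multipartiteCount (l ++ List.replicate (x + j) 1) := by
  have h1 := multipartiteCount_append l (x :: List.replicate j 1) (List.replicate (x + j) 1)
    (by simp)
  have h2 := multipartiteEdges_replicate_one j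
  have h3 := multipartiteEdges_replicate_one (x + j)
  simp only [multipartiteCount, multipartiteEdges, multipartiteCount_replicate_one,
    List.sum_replicate, smul_eq_mul, mul_one] at h1
  simp only [List.append_assoc, List.cons_append, List.nil_append]
  have h4 := mul_le_mul_of_nonneg_left h (natCast_mul_sub_one_nonneg x)
  push_cast at h3
  have h5 : 2 * (multipartiteEdges (List.replicate (x + j) 1)
      - (multipartiteEdges (List.replicate j 1) + x * j)) = x * (x - 1) := by
    linear_combination h3 - h2
  refine le_of_mul_le_mul_left (a := (2 : ℤ)) ?_ two_pos
  linear_combination h4 - 2 * h1 + x * (x - 1) * h2 - multipartiteNonedges l * h5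

theorem multipartiteCount_merge (l : List ℕ) (p q j : ℕ) (h : q ≤ j) :
    multipartiteCount (q :: p :: l ++ List.replicate j 1) ≤
      multipartiteCount ((q + p) :: l ++ List.replicate j 1) := by
  have h1 := le_multipartiteEdges_append_replicate l j
  simp only [List.cons_append, multipartiteCount, multipartiteEdges, List.sum_append,
    List.sum_replicate, smul_eq_mul, mul_one, Nat.cast_add]
  have h3 : (q : ℤ) ≤ j := by exact_mod_cast h
  have h4 : ((q : ℤ) - 1) * (j + l.sum) ≤ 2 * multipartiteEdges (l ++ List.replicate j 1) := by
    have : (0 : ℤ) ≤ l.sum := by positivity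
    nlinarith
  have h5 : (0 : ℤ) ≤ p * q := by positivity
  nlinarith [mul_le_mul_of_nonneg_left h4 h5]

theorem multipartiteCount_le (m : ℕ) : ∀ (l : List ℕ) (j : ℕ), l.length = m →
    ∃ s t : ℕ, s + t = l.sum + j ∧
      2 * multipartiteCount (l ++ List.replicate j 1) ≤ (s * (s - 1) : ℤ) * (t * (t - 1)) := by
  induction m with
  | zero =>
    intro l j hl
    obtain rfl := List.length_eq_zero_iff.mp hl
    exact ⟨0, j, by simp, by simp [multipartiteCount_replicate_one]⟩
  | succ m ih =>
    intro l j hl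
    match l, hl with
    | [q], _ =>
      refine ⟨q, j, by simp, ?_⟩
      simp only [List.cons_append, List.nil_append, multipartiteCount,
        multipartiteCount_replicate_one]
      linear_combination (q * (q - 1) : ℤ) * multipartiteEdges_replicate_one j
    | q :: p :: l, hl =>
      obtain ⟨l', x, hx⟩ : ∃ l' x, p :: l = l' ++ [x] :=
        ⟨_, _, (List.dropLast_append_getLast (by simp)).symm⟩
      by_cases h : (j : ℤ) * (j - 1) ≤ multipartiteNonedges (q :: l')
      · have hlen := congrArg List.length hx
        have hsum := congrArg List.sum hx
        simp at hlen hl hsum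
        obtain ⟨s, t, h1, h2⟩ := ih (q :: l') (x + j) (by simp; omega)
        refine ⟨s, t, by simp at h1 ⊢; omega, ?_⟩
        have := multipartiteCount_split (q :: l') x j h
        rw [hx, ← List.cons_append]
        linarith
      · obtain ⟨s, t, h1, h2⟩ := ih ((q + p) :: l) j (by simpa using hl)
        refine ⟨s, t, by simp at h1 ⊢; omega, ?_⟩
        have hqj : q ≤ j := by
          by_contra! hlt
          have := multipartiteNonedges_nonneg l'
          have hlt' : (j : ℤ) + 1 ≤ q := by exact_mod_cast hlt
          simp only [multipartiteNonedges] at h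
          nlinarith
        have := multipartiteCount_merge l p q j hqj
        linarith

/-- Among tournaments on weighted vertices, the transitive one ordered by weight maximizes the
number of copies of `H31` in the blow-up. -/
theorem exists_list_tournament {V : Type} [DecidableEq V] {G : V → V → Prop}
    [DecidableRel G] (hG : ∀ u v, ¬ (G u v ∧ G v u)) (w : V → ℕ) (s : Finset V) :
    ∃ l : List ℕ, l.sum = ∑ v ∈ s, w v ∧
      ∑ a ∈ s, ∑ b ∈ s, (if G a b then (w a * w b : ℤ) else 0) ≤ multipartiteEdges l ∧
      ∑ a ∈ s, ∑ b ∈ s, ∑ x ∈ s, (if G a b ∧ G a x ∧ G b x then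
        (w a * w b * (w x * (w x - 1)) : ℤ) else 0) ≤ multipartiteCount l := by
  have irr : ∀ v, ¬ G v v := fun v h => hG v v ⟨h, h⟩
  induction s using Finset.induction_on_max_value w with
  | empty => exact ⟨[], by simp, by simp [multipartiteEdges], by simp [multipartiteCount]⟩
  | insert q s hq hmax ih =>
    obtain ⟨l, h1, h2, h3⟩ := ih
    refine ⟨w q :: l, by simp [hq, h1], ?_, ?_⟩
    · simp only [sum_insert hq, irr, if_false, zero_add, sum_add_distrib, multipartiteEdges, h1]
      have : ∑ b ∈ s, (if G q b then (w q * w b : ℤ) else 0) +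
          ∑ a ∈ s, (if G a q then (w a * w q : ℤ) else 0) ≤ w q * ∑ v ∈ s, (w v : ℤ) := by
        rw [← sum_add_distrib, mul_sum]
        refine sum_le_sum fun v _ => ?_
        have h := hG q v
        have : (0 : ℤ) ≤ w q * w v := by positivity
        split_ifs <;> first | (exfalso; tauto) | linarith
      push_cast
      linarith
    · have key : ∑ a ∈ s, ∑ b ∈ s, ((if G a b ∧ G a q ∧ G b q then
            (w a * w b * (w q * (w q - 1)) : ℤ) else 0) +
          (if G q a ∧ G q b ∧ G a b then (w q * w a * (w b * (w b - 1)) : ℤ) else 0) +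
          (if G a q ∧ G a b ∧ G q b then (w a * w q * (w b * (w b - 1)) : ℤ) else 0))
          ≤ w q * (w q - 1) * ∑ a ∈ s, ∑ b ∈ s, (if G a b then (w a * w b : ℤ) else 0) := by
        simp only [mul_sum]
        refine sum_le_sum fun a ha => sum_le_sum fun b hb => ?_
        have hqa := hG q a
        have hqb := hG q b
        have hle : (w b : ℤ) ≤ w q := by exact_mod_cast hmax b hb
        have e1 : (w q * w a * (w b * (w b - 1)) : ℤ) ≤ w q * (w q - 1) * (w a * w b) := by
          have : (0 : ℤ) ≤ w q * w a * w b := by positivity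
          nlinarith
        have e2 : (0 : ℤ) ≤ w q * (w q - 1) * (w a * w b) :=
          mul_nonneg (natCast_mul_sub_one_nonneg _) (by positivity)
        by_cases hab : G a b
        swap
        · simp [hab]
        by_cases h1 : G a q <;> by_cases h2 : G b q <;> by_cases h3 : G q a <;>
          by_cases h4 : G q b <;>
          simp only [h1, h3, h2, h4, and_true, and_self, not_true, and_false] at hqa hqb <;>
          simp only [hab, h1, h2, h3, h4, and_true, and_false, if_true, if_false] <;> linarith
      have hedges := mul_le_mul_of_nonneg_left h2 (natCast_mul_sub_one_nonneg (w q))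
      simp only [sum_add_distrib] at key
      simp only [sum_insert hq, irr, false_and, and_false, if_false, zero_add,
        sum_const_zero, sum_add_distrib, multipartiteCount]
      simp_all
      linarith

theorem blowupCount_eq_of_tournament {V : Type} [Fintype V] [DecidableEq V] {G : V → V → Prop}
    [DecidableRel G] (hG : ∀ u v, ¬ (G u v ∧ G v u)) {w : V → ℤ}
    (ht : ∀ c d, c ≠ d → w c ≠ 0 → w d ≠ 0 → G c d ∨ G d c) :
    blowupCount G w = ∑ a, ∑ b, ∑ x, (if G a b ∧ G a x ∧ G b x then
        (w a * w b * (w x * (w x - 1)) : ℤ) else 0) := by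
  have irr : ∀ v, ¬ G v v := fun v h => hG v v ⟨h, h⟩
  unfold blowupCount
  refine sum_congr rfl fun a _ => sum_congr rfl fun b _ => ?_
  by_cases hab : G a b
  swap
  · simp [hab]
  simp only [hab, if_true, true_and, mul_sum]
  refine sum_congr rfl fun x _ => ?_
  rw [sum_eq_single x]
  · by_cases h1 : G a x <;> by_cases h2 : G b x <;> simp [h1, h2, irr]
  · intro y _ hyx
    have := ht x y hyx.symm
    split_ifs with h h'
    · exact absurd h'.symm hyx
    · by_cases hx : w x = 0
      · simp [hx]
      · by_cases hy : w y = 0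
        · simp [hy]
        · exact absurd (this hx hy) (by tauto)
    · exact mul_zero _
  · simp

theorem blowupCount_le {V : Type} [Fintype V] [DecidableEq V] {G : V → V → Prop}
    (hG : ∀ u v, ¬ (G u v ∧ G v u)) (k : ℕ) : ∀ w : V → ℤ, (∀ v, 0 ≤ w v) →
    #{v | w v ≠ 0} = k → ∃ s t : ℕ, ((s + t : ℕ) : ℤ) = ∑ v, w v ∧
      2 * blowupCount G w ≤ (s * (s - 1) : ℤ) * (t * (t - 1)) := by
  classical
  induction k using Nat.strong_induction_on with
  | _ k ih =>
  intro w hw hk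
  by_cases ht : ∀ c d, c ≠ d → w c ≠ 0 → w d ≠ 0 → G c d ∨ G d c
  · rw [blowupCount_eq_of_tournament hG ht]
    lift w to V → ℕ using hw
    obtain ⟨l, h1, -, h3⟩ := exists_list_tournament hG w univ
    obtain ⟨s, t, h4, h5⟩ := multipartiteCount_le _ l 0 rfl
    refine ⟨s, t, by rw [h4, add_zero, h1]; push_cast; rfl, ?_⟩
    simp only [List.replicate_zero, List.append_nil] at h5
    linarith
  · push Not at ht
    obtain ⟨c, d, hne, hc, hd, hcd, hdc⟩ := ht
    obtain ⟨L, R, hR, hq⟩ := blowupCount_quadratic hG hw hcd hdc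
    obtain ⟨t, hinc, hnonneg, hlt⟩ : ∃ t : ℤ, 0 ≤ t * L ∧
        (∀ v, 0 ≤ w v + t * (Pi.single c 1 - Pi.single d 1 : V → ℤ) v) ∧
        #{v | w v + t * (Pi.single c 1 - Pi.single d 1 : V → ℤ) v ≠ 0} < k := by
      have hwc := hw c
      have hwd := hw d
      have hsub : ∀ t : ℤ, ∀ z, w z ≠ 0 → (z = c ∨ z = d) →
          w z + t * (Pi.single c 1 - Pi.single d 1 : V → ℤ) z = 0 →
          #{v | w v + t * (Pi.single c 1 - Pi.single d 1 : V → ℤ) v ≠ 0} < k := by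
        intro t z hz hzcd h0
        rw [← hk]
        refine card_lt_card ((ssubset_iff_of_subset ?_).mpr ⟨z, by simp [hz], by simpa using h0⟩)
        intro v
        simp only [mem_filter, mem_univ, true_and]
        by_cases h1 : v = c
        · subst h1; simp [hc]
        · by_cases h2 : v = d
          · subst h2; simp [hd]
          · simp [h1, h2]
      rcases le_total 0 L with hL | hL
      · refine ⟨w d, mul_nonneg hwd hL, fun v => ?_, hsub _ d hd (.inr rfl) (by simp [hne.symm])⟩
        have := hw v
        simp only [Pi.sub_apply, Pi.single_apply]
        split_ifs with h1 h2 h2 <;> first | (subst h1; linarith) | (subst h2; linarith) | linarith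
      · refine ⟨-w c, by nlinarith, fun v => ?_, hsub _ c hc (.inl rfl) (by simp [hne])⟩
        have := hw v
        simp only [Pi.sub_apply, Pi.single_apply]
        split_ifs with h1 h2 h2 <;> first | (subst h1; linarith) | (subst h2; linarith) | linarith
    obtain ⟨s, t', h1, h2⟩ := ih _ hlt _ hnonneg rfl
    refine ⟨s, t', ?_, ?_⟩
    · rw [h1, sum_add_distrib, ← mul_sum]
      simp
    · rw [hq t] at h2
      have : 0 ≤ t ^ 2 * R := by positivity
      linarith

theorem two_mul_inducedCopies_le {n : ℕ} {G : Fin n → Fin n → Prop}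
    (hG : ∀ u v, ¬ (G u v ∧ G v u)) :
    2 * (inducedCopies H31 G : ℤ) ≤ blowupCount G (fun _ => 1) := by
  classical
  have irr : ∀ v, ¬ G v v := fun v h => hG v v ⟨h, h⟩
  let Q : Fin n × Fin n × Fin n × Fin n → Prop := fun z =>
    G z.1 z.2.1 ∧ G z.1 z.2.2.1 ∧ G z.2.1 z.2.2.1 ∧ G z.1 z.2.2.2 ∧ G z.2.1 z.2.2.2 ∧
      ¬ G z.2.2.1 z.2.2.2 ∧ ¬ G z.2.2.2 z.2.2.1
  have hcount : blowupCount G (fun _ => 1) = #{z | Q z ∧ z.2.2.1 ≠ z.2.2.2} := by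
    rw [card_filter]
    push_cast
    simp only [blowupCount, Fintype.sum_prod_type, Q]
    refine sum_congr rfl fun a _ => sum_congr rfl fun b _ => ?_
    by_cases hab : G a b
    · simp only [hab, if_true, one_mul, true_and]
      refine sum_congr rfl fun x _ => sum_congr rfl fun y _ => ?_
      by_cases hxy : x = y
      · simp [hxy]
      · simp only [hxy, if_false, sub_zero, ne_eq, not_false_eq_true, and_true]
    · simp [hab]
  have hcover : ∀ (r : Fin n → Fin n → Prop) [DecidableRel r], (∀ x y, x ≠ y → r x y ∨ r y x) →
      inducedCopies H31 G ≤ #{z | Q z ∧ r z.2.2.1 z.2.2.2} := by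
    intro r _ hr
    refine le_trans ?_ (card_image_le (f := fun z => ({z.1, z.2.1, z.2.2.1, z.2.2.2} : Finset (Fin n))))
    rw [← Set.ncard_coe_finset]
    refine Set.ncard_le_ncard ?_ (Finset.finite_toSet _)
    rintro S ⟨f, hf, rfl, hH⟩
    have himg : univ.image f = {f 0, f 1, f 2, f 3} := by
      ext v; simp [Fin.exists_fin_succ, eq_comm]
    have h01 : G (f 0) (f 1) := (hH 0 1).mp (by simp [H31])
    have h02 : G (f 0) (f 2) := (hH 0 2).mp (by simp [H31])
    have h03 : G (f 0) (f 3) := (hH 0 3).mp (by simp [H31])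
    have h12 : G (f 1) (f 2) := (hH 1 2).mp (by simp [H31])
    have h13 : G (f 1) (f 3) := (hH 1 3).mp (by simp [H31])
    have h23 : ¬ G (f 2) (f 3) := fun h => by simpa [H31] using (hH 2 3).mpr h
    have h32 : ¬ G (f 3) (f 2) := fun h => by simpa [H31] using (hH 3 2).mpr h
    simp only [coe_image, Set.mem_image, mem_coe, mem_filter, mem_univ, true_and, himg]
    rcases hr (f 2) (f 3) (hf.ne (by decide)) with h | h
    · exact ⟨(f 0, f 1, f 2, f 3), ⟨⟨h01, h02, h12, h03, h13, h23, h32⟩, h⟩, rfl⟩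
    · refine ⟨(f 0, f 1, f 3, f 2), ⟨⟨h01, h03, h13, h02, h12, h32, h23⟩, h⟩, ?_⟩
      ext v; simp; tauto
  have hlt := hcover (· < ·) fun x y h => lt_or_gt_of_ne h
  have hgt := hcover (· > ·) fun x y h => (lt_or_gt_of_ne h).symm
  have hsplit : #{z | Q z ∧ z.2.2.1 ≠ z.2.2.2} =
      #{z | Q z ∧ z.2.2.1 < z.2.2.2} + #{z | Q z ∧ z.2.2.1 > z.2.2.2} := by
    rw [← card_union_of_disjoint]
    · congr 1
      ext z
      simp only [mem_filter, mem_univ, true_and, mem_union, ne_iff_lt_or_gt]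
      tauto
    · rw [disjoint_filter]
      rintro z - ⟨-, h⟩ ⟨-, h'⟩
      exact lt_asymm h h'
  rw [hcount, hsplit]
  push_cast
  have hlt' : (inducedCopies H31 G : ℤ) ≤ #{z | Q z ∧ z.2.2.1 < z.2.2.2} := by exact_mod_cast hlt
  have hgt' : (inducedCopies H31 G : ℤ) ≤ #{z | Q z ∧ z.2.2.1 > z.2.2.2} := by exact_mod_cast hgt
  linarith

theorem two_mul_choose_two_cast (s : ℕ) : (2 * s.choose 2 : ℤ) = s * (s - 1) := by
  have h : ((s.choose 2 : ℕ) : ℚ) = s * (s - 1) / 2 := Nat.cast_choose_two ℚ s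
  have : (2 * s.choose 2 : ℚ) = s * (s - 1) := by rw [h]; ring
  exact_mod_cast this

theorem stmt1 (n : ℕ) (G : Fin n → Fin n → Prop) (hG : ∀ u v, ¬ (G u v ∧ G v u)) :
    inducedCopies H31 G ≤
      (Finset.range (n + 1)).sup (fun t => Nat.choose t 2 * Nat.choose (n - t) 2) := by
  obtain ⟨s, t, hst, hle⟩ := blowupCount_le hG _ (fun _ => 1) (fun _ => zero_le_one) rfl
  have hn : s + t = n := by
    simp only [sum_const, card_univ, Fintype.card_fin, nsmul_eq_mul, mul_one] at hst
    exact_mod_cast hst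
  have hcopies := two_mul_inducedCopies_le hG
  have hbound : inducedCopies H31 G ≤ s.choose 2 * t.choose 2 := by
    rw [← two_mul_choose_two_cast, ← two_mul_choose_two_cast] at hle
    have : (inducedCopies H31 G : ℤ) ≤ s.choose 2 * t.choose 2 := by linarith
    exact_mod_cast this
  obtain rfl : n - s = t := by omega
  exact hbound.trans
    (Finset.le_sup (f := fun t => Nat.choose t 2 * Nat.choose (n - t) 2) (by simp; omega))
end

section
/- The inducibility of H31 equals 3/8; that is, the sequence a_n = (max{N(H31,G) : G an oriented graph on n vertices}) / C(n,4) tends to 3/8 as n → ∞. -/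
/-- The maximum number of induced copies of `H` over all oriented graphs on `n` vertices. -/
noncomputable def maxCopies {k : ℕ} (H : Fin k → Fin k → Prop) (n : ℕ) : ℕ :=
  sSup {m : ℕ | ∃ G : Fin n → Fin n → Prop,
    (∀ u v, ¬ (G u v ∧ G v u)) ∧ m = inducedCopies H G}

/-- The total weight of transitive triples in a transitive tournament whose vertices have the
weights listed (sink first), placed above an infinitely divisible mass `t`, the sink of each
triple being counted with its weight squared. -/
noncomputable def stackWeight (t : ℝ) : List ℝ → ℝ
  | [] => 0
  | x :: L => x ^ 2 * ((t + L.sum) ^ 2 - (L.map (· ^ 2)).sum) / 2 + stackWeight t L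

theorem sum_sq_le_sq_sum_of_nonneg (L : List ℝ) (hL : ∀ x ∈ L, 0 ≤ x) :
    (L.map (· ^ 2)).sum ≤ L.sum ^ 2 := by
  induction L with
  | nil => simp
  | cons x L ih =>
    have hx : 0 ≤ x := hL x (by simp)
    have hL' : ∀ y ∈ L, 0 ≤ y := fun y hy => hL y (by simp [hy])
    have hs : 0 ≤ L.sum := List.sum_nonneg hL'
    have := ih hL'
    simp only [List.map_cons, List.sum_cons]
    nlinarith [mul_nonneg hx hs]

theorem stackWeight_concat (t y : ℝ) (L : List ℝ) :
    stackWeight t (L ++ [y]) =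
      stackWeight (t + y) L + y ^ 2 * (t ^ 2 - (L.map (· ^ 2)).sum) / 2 := by
  induction L with
  | nil => simp [stackWeight]
  | cons x L ih =>
    simp only [List.cons_append, stackWeight, ih, List.sum_append, List.map_append,
      List.map_cons, List.sum_cons, List.map_nil, List.sum_nil]
    ring

theorem stackWeight_le_merge (t M x : ℝ) (L : List ℝ) (hM : 0 ≤ M) (hx : 0 ≤ x)
    (hL : ∀ y ∈ L, 0 ≤ y) (hMt : M ≤ t) :
    stackWeight t (M :: x :: L) ≤ stackWeight t ((M + x) :: L) := by
  have hs : 0 ≤ L.sum := List.sum_nonneg hL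
  have hq := sum_sq_le_sq_sum_of_nonneg L hL
  simp only [stackWeight, List.map_cons, List.sum_cons]
  have hpos : 0 ≤ (t + L.sum) ^ 2 - (L.map (· ^ 2)).sum - M * (t + L.sum) := by
    nlinarith [mul_nonneg (hM.trans hMt) (sub_nonneg.2 hMt), mul_nonneg hs (sub_nonneg.2 hMt),
      mul_nonneg hs (hM.trans hMt)]
  nlinarith [mul_nonneg (mul_nonneg hM hx) hpos]

theorem stackWeight_le (L : List ℝ) (t : ℝ) (ht : 0 ≤ t) (hL : ∀ x ∈ L, 0 ≤ x) :
    stackWeight t L ≤ (t + L.sum) ^ 4 / 32 := by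
  induction hn : L.length generalizing L t with
  | zero =>
    rw [List.length_eq_zero_iff] at hn
    subst hn
    simp only [stackWeight]
    positivity
  | succ n ih =>
    match L, hL, hn with
    | [x], hL, _ =>
      have hx : 0 ≤ x := hL x (by simp)
      simp only [stackWeight, List.map_nil, List.sum_nil, List.sum_cons]
      nlinarith [mul_nonneg (sq_nonneg (t - x)) (sq_nonneg (t + x)),
        mul_nonneg (sq_nonneg (t - x)) (mul_nonneg ht hx)]
    | M :: x :: L, hL, hn =>
      have hM : 0 ≤ M := hL M (by simp)
      have hx : 0 ≤ x := hL x (by simp)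
      have hL' : ∀ y ∈ L, 0 ≤ y := fun y hy => hL y (by simp [hy])
      by_cases hMt : M ≤ t
      · refine (stackWeight_le_merge t M x L hM hx hL' hMt).trans ?_
        refine (ih ((M + x) :: L) t ht ?_ (by simpa using hn)).trans_eq ?_
        · simpa using ⟨add_nonneg hM hx, hL'⟩
        · simp only [List.sum_cons]
          ring
      · obtain ⟨K, y, hK⟩ : ∃ K y, x :: L = K ++ [y] :=
          ⟨_, _, (List.dropLast_append_getLast (List.cons_ne_nil x L)).symm⟩
        rw [hK] at hL hn ⊢
        have hy : 0 ≤ y := hL y (by simp)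
        have hK' : ∀ z ∈ M :: K, 0 ≤ z := fun z hz => hL z (by simp at hz ⊢; tauto)
        rw [← List.cons_append, stackWeight_concat]
        have h1 := ih (M :: K) (t + y) (add_nonneg ht hy) hK' (by simpa using hn)
        have hQ : t ^ 2 ≤ ((M :: K).map (· ^ 2)).sum := by
          have : 0 ≤ (K.map (· ^ 2)).sum := List.sum_nonneg (by simp +contextual [sq_nonneg])
          simp only [List.map_cons, List.sum_cons]
          nlinarith
        have h2 := mul_nonneg (sq_nonneg y) (sub_nonneg.2 hQ)
        have h3 : ((M :: K) ++ [y]).sum = y + (M :: K).sum := by simp [add_comm, add_left_comm]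
        rw [h3, ← add_assoc]
        linarith

open Classical in
/-- The weight of a transitive triple `a → b → c`, `a → c`, with the sink weight squared. -/
noncomputable def tripleWeight {V : Type} (G : V → V → Prop) (x : V → ℝ) (a b c : V) : ℝ :=
  if G a b ∧ G a c ∧ G b c then x a * x b * x c ^ 2 else 0

open Classical in
theorem sum_arcs_le {V : Type} (G : V → V → Prop) (hG : ∀ u v, ¬ (G u v ∧ G v u))
    (x : V → ℝ) (hx : ∀ v, 0 ≤ x v) (S : Finset V) :
    ∑ a ∈ S, ∑ b ∈ S, (if G a b then x a * x b else 0) ≤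
      ((∑ a ∈ S, x a) ^ 2 - ∑ a ∈ S, x a ^ 2) / 2 := by
  have hdiag : ∑ a ∈ S, x a ^ 2 = ∑ a ∈ S, ∑ b ∈ S, if a = b then x a * x b else 0 := by
    refine Finset.sum_congr rfl fun a ha => ?_
    simp [ha, sq]
  have hswap : ∑ a ∈ S, ∑ b ∈ S, (if G a b then x a * x b else 0) =
      ∑ a ∈ S, ∑ b ∈ S, (if G b a then x a * x b else 0) := by
    rw [Finset.sum_comm]
    simp only [mul_comm]
  have hle : ∑ a ∈ S, ∑ b ∈ S, (if G a b then x a * x b else 0) +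
      ∑ a ∈ S, ∑ b ∈ S, (if G b a then x a * x b else 0) +
      ∑ a ∈ S, ∑ b ∈ S, (if a = b then x a * x b else 0) ≤ (∑ a ∈ S, x a) ^ 2 := by
    rw [sq, Finset.sum_mul_sum]
    simp only [← Finset.sum_add_distrib]
    refine Finset.sum_le_sum fun a _ => Finset.sum_le_sum fun b _ => ?_
    have h0 := mul_nonneg (hx a) (hx b)
    have h1 := hG a b
    by_cases h2 : a = b
    · subst h2
      have h3 : ¬ G a a := fun h => h1 ⟨h, h⟩
      simp [h3]
    · by_cases h3 : G a b <;> by_cases h4 : G b a <;> simp [h2, h3, h4, h0]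
      exact absurd ⟨h3, h4⟩ h1
  linarith

theorem sum_tripleWeight_insert_le {V : Type} [DecidableEq V] (G : V → V → Prop)
    (hG : ∀ u v, ¬ (G u v ∧ G v u)) (x : V → ℝ) (hx : ∀ v, 0 ≤ x v) (m : V) (S : Finset V)
    (hm : m ∉ S) (hmax : ∀ v ∈ S, x v ≤ x m) :
    ∑ a ∈ insert m S, ∑ b ∈ insert m S, ∑ c ∈ insert m S, tripleWeight G x a b c ≤
      x m ^ 2 * ((∑ a ∈ S, x a) ^ 2 - ∑ a ∈ S, x a ^ 2) / 2 +
        ∑ a ∈ S, ∑ b ∈ S, ∑ c ∈ S, tripleWeight G x a b c := by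
  classical
  have hirr : ∀ v, ¬ G v v := fun v h => hG v v ⟨h, h⟩
  have haa : ∀ a b, tripleWeight G x a a b = 0 := fun a b => by simp [tripleWeight, hirr]
  have hab : ∀ a b, tripleWeight G x a b a = 0 := fun a b => by simp [tripleWeight, hirr]
  have hbb : ∀ a b, tripleWeight G x a b b = 0 := fun a b => by simp [tripleWeight, hirr]
  simp only [Finset.sum_insert hm, haa, hab, hbb, Finset.sum_add_distrib, Finset.sum_const_zero,
    zero_add]
  have key : ∑ a ∈ S, ∑ b ∈ S, tripleWeight G x m a b + ∑ a ∈ S, ∑ b ∈ S, tripleWeight G x a m b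
      + ∑ a ∈ S, ∑ b ∈ S, tripleWeight G x a b m ≤
      x m ^ 2 * ∑ a ∈ S, ∑ b ∈ S, (if G a b then x a * x b else 0) := by
    simp only [← Finset.sum_add_distrib, Finset.mul_sum]
    refine Finset.sum_le_sum fun a _ => Finset.sum_le_sum fun b hb => ?_
    have h1 := hG a m
    have h2 := hG b m
    have h3 : x m * x a * x b ^ 2 ≤ x m ^ 2 * (x a * x b) := by
      nlinarith [mul_le_mul_of_nonneg_left (hmax b hb)
        (mul_nonneg (mul_nonneg (hx m) (hx a)) (hx b))]
    have h4 : 0 ≤ x m ^ 2 * (x a * x b) := mul_nonneg (sq_nonneg _) (mul_nonneg (hx a) (hx b))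
    simp only [tripleWeight]
    by_cases hab : G a b
    · by_cases h5 : G a m <;> by_cases h6 : G m a <;> by_cases h7 : G b m <;>
        by_cases h8 : G m b <;> simp only [hab, h5, h6, h7, h8, and_true, and_false,
          if_true, if_false, not_true, not_false_eq_true, and_self] at h1 h2 ⊢ <;>
        nlinarith
    · simp [hab]
  have := mul_le_mul_of_nonneg_left (sum_arcs_le G hG x hx S) (sq_nonneg (x m))
  linarith

theorem exists_list_sum_tripleWeight_le {V : Type} [DecidableEq V] (G : V → V → Prop)
    (hG : ∀ u v, ¬ (G u v ∧ G v u)) (x : V → ℝ) (hx : ∀ v, 0 ≤ x v) (S : Finset V) :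
    ∃ L : List ℝ, (∀ y ∈ L, 0 ≤ y) ∧ L.sum = ∑ a ∈ S, x a ∧
      (L.map (· ^ 2)).sum = ∑ a ∈ S, x a ^ 2 ∧
      ∑ a ∈ S, ∑ b ∈ S, ∑ c ∈ S, tripleWeight G x a b c ≤ stackWeight 0 L := by
  induction S using Finset.induction_on_max_value x with
  | empty => exact ⟨[], by simp [stackWeight]⟩
  | insert m S hm hmax ih =>
    obtain ⟨L, hL, hsum, hsq, hle⟩ := ih
    refine ⟨x m :: L, by simpa using ⟨hx m, hL⟩, by simp [Finset.sum_insert hm, hsum],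
      by simp only [List.map_cons, List.sum_cons, Finset.sum_insert hm, hsq], ?_⟩
    refine (sum_tripleWeight_insert_le G hG x hx m S hm hmax).trans ?_
    simp only [stackWeight, hsum, hsq, zero_add]
    linarith

theorem sum_tripleWeight_le {V : Type} [Fintype V] (G : V → V → Prop)
    (hG : ∀ u v, ¬ (G u v ∧ G v u)) (x : V → ℝ) (hx : ∀ v, 0 ≤ x v) :
    ∑ a, ∑ b, ∑ c, tripleWeight G x a b c ≤ (∑ a, x a) ^ 4 / 32 := by
  classical
  obtain ⟨L, hL, hsum, -, hle⟩ := exists_list_sum_tripleWeight_le G hG x hx Finset.univ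
  have := stackWeight_le L 0 le_rfl hL
  rw [hsum, zero_add] at this
  exact hle.trans this

/-- The vertices `a, b, c, d` play the roles of `0, 1, 2, 3` in `H31`, except that `c = d` is
allowed when `G` is irreflexive. -/
def IsH31Tuple {V : Type} (G : V → V → Prop) (a b c d : V) : Prop :=
  G a b ∧ (G a c ∧ G b c) ∧ (G a d ∧ G b d) ∧ ¬ G c d ∧ ¬ G d c

open Classical in
/-- The number of `H31`-tuples of `G`, each weighted by the product of its vertex weights. -/
noncomputable def h31Weight {V : Type} [Fintype V] (G : V → V → Prop) (x : V → ℝ) : ℝ :=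
  ∑ a, ∑ b, ∑ c, ∑ d, if IsH31Tuple G a b c d then x a * x b * x c * x d else 0

open Classical in
/-- Shifting weight between two non-adjacent vertices changes `h31Weight` by a convex quadratic. -/
theorem h31Weight_shift {V : Type} [Fintype V] (G : V → V → Prop)
    (x : V → ℝ) (hx : ∀ v, 0 ≤ x v) (δ : V → ℝ)
    (hδ : ∀ a b, G a b → δ a * δ b = 0)
    (hδ' : ∀ a b, δ a ≠ 0 → δ b ≠ 0 → ¬ G a b) :
    ∃ B C : ℝ, 0 ≤ C ∧ ∀ s : ℝ,
      h31Weight G (fun v => x v + s * δ v) = h31Weight G x + s * B + s ^ 2 * C := by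
  refine ⟨∑ a, ∑ b, ∑ c, ∑ d, if IsH31Tuple G a b c d then
      δ a * x b * x c * x d + x a * δ b * x c * x d + x a * x b * δ c * x d
        + x a * x b * x c * δ d else 0,
    ∑ a, ∑ b, (if G a b then x a * x b else 0) *
      (∑ c, if G a c ∧ G b c then δ c else 0) ^ 2, ?_, fun s => ?_⟩
  · refine Finset.sum_nonneg fun a _ => Finset.sum_nonneg fun b _ => ?_
    refine mul_nonneg ?_ (sq_nonneg _)
    split_ifs
    exacts [mul_nonneg (hx a) (hx b), le_rfl]
  · simp only [h31Weight, sq (Finset.sum _ _), Finset.sum_mul_sum]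
    simp only [Finset.mul_sum, ← Finset.sum_add_distrib]
    refine Finset.sum_congr rfl fun a _ => Finset.sum_congr rfl fun b _ =>
      Finset.sum_congr rfl fun c _ => Finset.sum_congr rfl fun d _ => ?_
    by_cases h : IsH31Tuple G a b c d
    · obtain ⟨hab, ⟨hac, hbc⟩, ⟨had, hbd⟩, -, -⟩ := id h
      have e1 := hδ a b hab
      have e2 := hδ a c hac
      have e3 := hδ b c hbc
      have e4 := hδ a d had
      have e5 := hδ b d hbd
      simp only [h, hab, hac, hbc, had, hbd, if_true, and_self]
      linear_combination (s ^ 2 * (x c + s * δ c) * (x d + s * δ d)) * e1 +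
        (s ^ 2 * x b * (x d + s * δ d)) * e2 + (s ^ 2 * x a * (x d + s * δ d)) * e3 +
        (s ^ 2 * x b * x c) * e4 + (s ^ 2 * x a * x c) * e5
    · simp only [h, if_false]
      by_cases h1 : G a b ∧ (G a c ∧ G b c) ∧ (G a d ∧ G b d)
      · have h2 : δ c * δ d = 0 := by
          by_contra hne
          obtain ⟨hc, hd⟩ := mul_ne_zero_iff.1 hne
          exact h ⟨h1.1, h1.2.1, h1.2.2, hδ' c d hc hd, hδ' d c hd hc⟩
        simp only [h1, if_true, and_self, h2]
        ring
      · by_cases h3 : G a b <;> by_cases h4 : G a c ∧ G b c <;>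
          by_cases h5 : G a d ∧ G b d <;> simp_all

theorem h31Weight_eq_of_complete {V : Type} [Fintype V] (G : V → V → Prop)
    (hG : ∀ u v, ¬ (G u v ∧ G v u)) (x : V → ℝ)
    (hcomp : ∀ u v, u ≠ v → x u ≠ 0 → x v ≠ 0 → G u v ∨ G v u) :
    h31Weight G x = ∑ a, ∑ b, ∑ c, tripleWeight G x a b c := by
  classical
  refine Finset.sum_congr rfl fun a _ => Finset.sum_congr rfl fun b _ =>
    Finset.sum_congr rfl fun c _ => ?_
  rw [Finset.sum_eq_single c]
  · have hc : ¬ G c c := fun h => hG c c ⟨h, h⟩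
    simp only [IsH31Tuple, tripleWeight, hc, not_false_eq_true, and_true, and_self]
    refine if_congr Iff.rfl (by ring) rfl
  · intro d _ hdc
    split_ifs with h
    · by_cases hc : x c = 0
      · simp [hc]
      by_cases hd : x d = 0
      · simp [hd]
      exact absurd (hcomp d c hdc hd hc) (not_or.2 ⟨h.2.2.2.2, h.2.2.2.1⟩)
    · rfl
  · simp

theorem h31Weight_le {V : Type} [Fintype V] (G : V → V → Prop)
    (hG : ∀ u v, ¬ (G u v ∧ G v u)) (x : V → ℝ) (hx : ∀ v, 0 ≤ x v) :
    h31Weight G x ≤ (∑ a, x a) ^ 4 / 32 := by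
  classical
  induction hn : (Finset.univ.filter fun v => x v ≠ 0).card using Nat.strong_induction_on
    generalizing x with
  | _ n ih =>
    subst hn
    by_cases hcomp : ∀ u v, u ≠ v → x u ≠ 0 → x v ≠ 0 → G u v ∨ G v u
    · rw [h31Weight_eq_of_complete G hG x hcomp]
      exact sum_tripleWeight_le G hG x hx
    push Not at hcomp
    obtain ⟨u, v, huv, hu, hv, hnuv, hnvu⟩ := hcomp
    let δ : V → ℝ := fun w => if w = u then 1 else if w = v then -1 else 0
    have hδu : δ u = 1 := by simp [δ]
    have hδv : δ v = -1 := by simp [δ, huv.symm]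
    have hδw : ∀ w, w ≠ u → w ≠ v → δ w = 0 := fun w h1 h2 => by simp [δ, h1, h2]
    have hirr : ∀ v, ¬ G v v := fun v h => hG v v ⟨h, h⟩
    have hmem : ∀ w, δ w ≠ 0 → w = u ∨ w = v := fun w hw => by
      by_contra h
      push Not at h
      exact hw (hδw w h.1 h.2)
    have hδ' : ∀ a b, δ a ≠ 0 → δ b ≠ 0 → ¬ G a b := fun a b ha hb => by
      rcases hmem a ha with rfl | rfl <;> rcases hmem b hb with rfl | rfl <;>
        first | exact hirr _ | assumption
    have hδ : ∀ a b, G a b → δ a * δ b = 0 := fun a b hab => by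
      by_contra hne
      obtain ⟨ha, hb⟩ := mul_ne_zero_iff.1 hne
      exact hδ' a b ha hb hab
    have hδsum : ∑ w, δ w = 0 := by
      rw [Fintype.sum_eq_add u v huv fun w hw => hδw w hw.1 hw.2, hδu, hδv]
      norm_num
    obtain ⟨B, C, hC, hBC⟩ := h31Weight_shift G x hx δ hδ hδ'
    have step : ∀ s : ℝ, -x u ≤ s → s ≤ x v → (s = -x u ∨ s = x v) → 0 ≤ s * B →
        h31Weight G x ≤ (∑ a, x a) ^ 4 / 32 := by
      intro s hs1 hs2 hs hsB
      have hnn : ∀ w, 0 ≤ x w + s * δ w := fun w => by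
        by_cases h1 : w = u
        · subst h1; rw [hδu]; linarith
        by_cases h2 : w = v
        · subst h2; rw [hδv]; linarith
        rw [hδw w h1 h2]; linarith [hx w]
      have hlt : (Finset.univ.filter fun w => x w + s * δ w ≠ 0).card <
          (Finset.univ.filter fun w => x w ≠ 0).card := by
        refine Finset.card_lt_card (Finset.ssubset_iff_of_subset ?_ |>.2 ?_)
        · intro w
          simp only [Finset.mem_filter, Finset.mem_univ, true_and]
          intro hw
          by_cases h1 : w = u
          · rwa [h1]
          by_cases h2 : w = v
          · rwa [h2]
          simpa [hδw w h1 h2] using hw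
        · rcases hs with rfl | rfl
          · exact ⟨u, by simp [hu], by simp [hδu]⟩
          · exact ⟨v, by simp [hv], by simp [hδv]⟩
      have := ih _ hlt (fun w => x w + s * δ w) hnn rfl
      rw [hBC, Finset.sum_add_distrib, ← Finset.mul_sum, hδsum, mul_zero, add_zero] at this
      nlinarith [mul_nonneg (sq_nonneg s) hC]
    rcases le_total 0 B with hB | hB
    · exact step (x v) (by linarith [hx u, hx v]) le_rfl (Or.inr rfl) (mul_nonneg (hx v) hB)
    · exact step (-x u) le_rfl (by linarith [hx u, hx v]) (Or.inl rfl)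
        (by nlinarith [hx u])

theorem two_mul_inducedCopies_le_s2 {V : Type} [Fintype V] [DecidableEq V] (G : V → V → Prop) :
    2 * (inducedCopies H31 G : ℝ) ≤ h31Weight G fun _ => 1 := by
  classical
  let T : Finset (V × V × V × V) :=
    Finset.univ.filter fun p => IsH31Tuple G p.1 p.2.1 p.2.2.1 p.2.2.2
  have hT : h31Weight G (fun _ => 1) = (T.card : ℝ) := by
    simp only [T, h31Weight, Finset.card_filter, Nat.cast_sum, Fintype.sum_prod_type, mul_one,
      Nat.cast_ite, Nat.cast_one, Nat.cast_zero]
  let N : Finset (Finset V) := Finset.univ.filter fun S => ∃ f : Fin 4 → V,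
    Function.Injective f ∧ Finset.univ.image f = S ∧ ∀ i j, H31 i j ↔ G (f i) (f j)
  have hN : inducedCopies H31 G = N.card := by
    rw [inducedCopies, ← Set.ncard_coe_finset]
    simp [N]
  have hcard : N.card * 2 ≤ T.card := by
    let φ : V × V × V × V → Finset V := fun p => {p.1, p.2.1, p.2.2.1, p.2.2.2}
    have hfib : ∀ S ∈ N, 2 ≤ (T.filter fun p => φ p = S).card := by
      intro S hS
      obtain ⟨f, hf, rfl, hH⟩ := (Finset.mem_filter.1 hS).2
      have hH' : ∀ i j, G (f i) (f j) ↔ H31 i j := fun i j => (hH i j).symm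
      rw [← Nat.lt_iff_add_one_le, Finset.one_lt_card]
      refine ⟨(f 0, f 1, f 2, f 3), ?_, (f 0, f 1, f 3, f 2), ?_, ?_⟩
      · simp only [T, φ, Finset.mem_filter, Finset.mem_univ, true_and]
        refine ⟨by simp [IsH31Tuple, hH', H31], ?_⟩
        ext w
        simp [Fin.exists_fin_succ, eq_comm]
      · simp only [T, φ, Finset.mem_filter, Finset.mem_univ, true_and]
        refine ⟨by simp [IsH31Tuple, hH', H31], ?_⟩
        ext w
        simp [Fin.exists_fin_succ, eq_comm]
        tauto
      · simp [hf.eq_iff]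
    calc N.card * 2 = ∑ S ∈ N, 2 := by simp
      _ ≤ ∑ S ∈ N, (T.filter fun p => φ p = S).card := Finset.sum_le_sum hfib
      _ ≤ T.card := (Finset.sum_card_fiberwise_eq_card_filter T N φ).trans_le
        (Finset.card_filter_le _ _)
  rw [hT, hN]
  exact_mod_cast (by omega : 2 * N.card ≤ T.card)

theorem inducedCopies_H31_le {n : ℕ} (G : Fin n → Fin n → Prop)
    (hG : ∀ u v, ¬ (G u v ∧ G v u)) : (inducedCopies H31 G : ℝ) ≤ n ^ 4 / 64 := by
  have h1 := two_mul_inducedCopies_le_s2 G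
  have h2 := h31Weight_le G hG (fun _ => 1) fun _ => zero_le_one
  simp only [Finset.sum_const, Finset.card_univ, Fintype.card_fin, nsmul_eq_mul, mul_one] at h2
  linarith

/-- The oriented graph consisting of a transitive tournament on the vertices below `k`, all of
which dominate an independent set formed by the other vertices. -/
def tournamentOverIndependent (n k : ℕ) : Fin n → Fin n → Prop :=
  fun u v => u < v ∧ (u : ℕ) < k

theorem choose_mul_choose_le_inducedCopies (n k : ℕ) (hk : k ≤ n) :
    k.choose 2 * (n - k).choose 2 ≤ inducedCopies H31 (tournamentOverIndependent n k) := by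
  classical
  let A : Finset (Fin n) := Finset.univ.filter fun v => (v : ℕ) < k
  let B : Finset (Fin n) := Finset.univ.filter fun v => ¬ (v : ℕ) < k
  have hA : A.card = k := by
    simp only [A, Fin.card_filter_val_lt]
    omega
  have hB : B.card = n - k := by
    have := Finset.card_filter_add_card_filter_not (s := (Finset.univ : Finset (Fin n)))
      (fun v => (v : ℕ) < k)
    simp only [Finset.card_univ, Fintype.card_fin] at this
    change A.card + B.card = n at this
    omega
  let P := A.powersetCard 2 ×ˢ B.powersetCard 2
  have hP : P.card = k.choose 2 * (n - k).choose 2 := by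
    simp [P, Finset.card_product, hA, hB]
  rw [← hP, inducedCopies, ← Set.ncard_coe_finset]
  refine Set.ncard_le_ncard_of_injOn (fun p => p.1 ∪ p.2) ?_ ?_ (Set.toFinite _)
  · rintro ⟨X, Y⟩ hXY
    simp only [P, Finset.coe_product, Set.mem_prod, Finset.mem_coe, Finset.mem_powersetCard]
      at hXY
    obtain ⟨⟨hXA, hX⟩, hYB, hY⟩ := hXY
    obtain ⟨a, b, hab, rfl⟩ : ∃ a b, a < b ∧ X = {a, b} := by
      obtain ⟨a, b, hab, rfl⟩ := Finset.card_eq_two.1 hX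
      rcases lt_or_gt_of_ne hab with h | h
      exacts [⟨a, b, h, rfl⟩, ⟨b, a, h, Finset.pair_comm a b⟩]
    obtain ⟨c, d, hcd, rfl⟩ := Finset.card_eq_two.1 hY
    have ha : (a : ℕ) < k := (Finset.mem_filter.1 (hXA (by simp : a ∈ ({a, b} : Finset _)))).2
    have hb : (b : ℕ) < k := (Finset.mem_filter.1 (hXA (by simp : b ∈ ({a, b} : Finset _)))).2
    have hc : ¬ (c : ℕ) < k := (Finset.mem_filter.1 (hYB (by simp : c ∈ ({c, d} : Finset _)))).2
    have hd : ¬ (d : ℕ) < k := (Finset.mem_filter.1 (hYB (by simp : d ∈ ({c, d} : Finset _)))).2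
    rw [Fin.lt_def] at hab
    rw [Ne, Fin.ext_iff] at hcd
    refine ⟨![a, b, c, d], ?_, ?_, ?_⟩
    · intro i j
      fin_cases i <;> fin_cases j <;> simp [Fin.ext_iff] <;> omega
    · ext w
      simp [Fin.exists_fin_succ, eq_comm]
      tauto
    · intro i j
      simp only [tournamentOverIndependent, Fin.lt_def]
      fin_cases i <;> fin_cases j <;> simp [H31, -Fin.val_fin_lt] <;> omega
  · rintro ⟨X, Y⟩ hXY ⟨X', Y'⟩ hXY' h
    simp only [P, Finset.coe_product, Set.mem_prod, Finset.mem_coe, Finset.mem_powersetCard]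
      at hXY hXY'
    have hfA : ∀ X Y : Finset (Fin n), X ⊆ A → Y ⊆ B → (X ∪ Y) ∩ A = X := by
      intro X Y hX hY
      ext w
      have h1 := @hX w
      have h2 := @hY w
      simp only [A, B, Finset.mem_filter, Finset.mem_univ, true_and, Finset.mem_inter,
        Finset.mem_union] at h1 h2 ⊢
      tauto
    have hfB : ∀ X Y : Finset (Fin n), X ⊆ A → Y ⊆ B → (X ∪ Y) ∩ B = Y := by
      intro X Y hX hY
      ext w
      have h1 := @hX w
      have h2 := @hY w
      simp only [A, B, Finset.mem_filter, Finset.mem_univ, true_and, Finset.mem_inter,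
        Finset.mem_union] at h1 h2 ⊢
      tauto
    have h' : X ∪ Y = X' ∪ Y' := h
    rw [Prod.mk.injEq]
    constructor
    · rw [← hfA X Y hXY.1.1 hXY.2.1, h', hfA X' Y' hXY'.1.1 hXY'.2.1]
    · rw [← hfB X Y hXY.1.1 hXY.2.1, h', hfB X' Y' hXY'.1.1 hXY'.2.1]

theorem tournamentOverIndependent_asymm (n k : ℕ) (u v : Fin n) :
    ¬ (tournamentOverIndependent n k u v ∧ tournamentOverIndependent n k v u) :=
  fun h => lt_asymm h.1.1 h.2.1

theorem bddAbove_inducedCopies_H31 (n : ℕ) : BddAbove {m : ℕ | ∃ G : Fin n → Fin n → Prop,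
    (∀ u v, ¬ (G u v ∧ G v u)) ∧ m = inducedCopies H31 G} := by
  refine ⟨n ^ 4, ?_⟩
  rintro m ⟨G, hG, rfl⟩
  have h := inducedCopies_H31_le G hG
  have h0 : (0 : ℝ) ≤ (n : ℝ) ^ 4 := by positivity
  have : (inducedCopies H31 G : ℝ) ≤ (n : ℝ) ^ 4 := by linarith
  exact_mod_cast this

theorem maxCopies_H31_le (n : ℕ) : (maxCopies H31 n : ℝ) ≤ n ^ 4 / 64 := by
  have hne : {m : ℕ | ∃ G : Fin n → Fin n → Prop,
      (∀ u v, ¬ (G u v ∧ G v u)) ∧ m = inducedCopies H31 G}.Nonempty :=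
    ⟨_, _, tournamentOverIndependent_asymm n 0, rfl⟩
  obtain ⟨G, hG, hm⟩ := Nat.sSup_mem hne (bddAbove_inducedCopies_H31 n)
  rw [maxCopies, hm]
  exact inducedCopies_H31_le G hG

theorem cast_choose_four (n : ℕ) :
    (n.choose 4 : ℝ) = n * (n - 1) * (n - 2) * (n - 3) / 24 := by
  have h3 (m : ℕ) : (m.choose 3 : ℝ) = m * (m - 1) * (m - 2) / 6 := by
    induction m with
    | zero => simp
    | succ m ih =>
      rw [Nat.choose_succ_succ', Nat.cast_add, ih, Nat.cast_choose_two]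
      push_cast
      ring
  induction n with
  | zero => simp
  | succ n ih =>
    rw [Nat.choose_succ_succ', Nat.cast_add, ih, h3]
    push_cast
    ring

theorem le_maxCopies_H31 (n : ℕ) (hn : 4 ≤ n) :
    3 / 8 * (n.choose 4 : ℝ) ≤ maxCopies H31 n := by
  have h1 : (n / 2).choose 2 * (n - n / 2).choose 2 ≤ maxCopies H31 n :=
    (choose_mul_choose_le_inducedCopies n (n / 2) (Nat.div_le_self n 2)).trans
      (le_csSup (bddAbove_inducedCopies_H31 n)
        ⟨_, tournamentOverIndependent_asymm n (n / 2), rfl⟩)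
  have h2 : (((n / 2).choose 2 * (n - n / 2).choose 2 : ℕ) : ℝ) ≤ maxCopies H31 n := by
    exact_mod_cast h1
  refine le_trans ?_ h2
  rw [cast_choose_four, Nat.cast_mul, Nat.cast_choose_two, Nat.cast_choose_two,
    Nat.cast_sub (Nat.div_le_self n 2)]
  have hn' : (4 : ℝ) ≤ n := by exact_mod_cast hn
  rcases Nat.even_or_odd' n with ⟨k, hk | hk⟩
  · have e1 : n / 2 = k := by omega
    have e2 : (n : ℝ) = 2 * k := by exact_mod_cast hk
    rw [e1, e2]
    rw [e2] at hn'
    have hk2 : (2 : ℝ) ≤ k := by linarith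
    have : 0 ≤ (k : ℝ) * (k - 1) * (k - 1) := by
      have : (0 : ℝ) ≤ k - 1 := by linarith
      positivity
    nlinarith
  · have e1 : n / 2 = k := by omega
    have e2 : (n : ℝ) = 2 * k + 1 := by exact_mod_cast hk
    rw [e1, e2]
    rw [e2] at hn'
    have hk2 : (3 / 2 : ℝ) ≤ k := by linarith
    have : 0 ≤ (k : ℝ) * (k - 1) * k := by
      have : (0 : ℝ) ≤ k - 1 := by linarith
      positivity
    nlinarith

theorem stmt2 :
    Filter.Tendsto (fun n : ℕ => (maxCopies H31 n : ℝ) / (Nat.choose n 4 : ℝ))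
      Filter.atTop (nhds (3 / 8)) := by
  have hlim : Filter.Tendsto (fun n : ℕ => (3 / 8 : ℝ) * ((1 - 1 * (n : ℝ)⁻¹) *
      (1 - 2 * (n : ℝ)⁻¹) * (1 - 3 * (n : ℝ)⁻¹))⁻¹) Filter.atTop (nhds (3 / 8)) := by
    have h (c : ℝ) : Filter.Tendsto (fun n : ℕ => 1 - c * (n : ℝ)⁻¹) Filter.atTop (nhds 1) := by
      simpa using (tendsto_inv_atTop_nhds_zero_nat (𝕜 := ℝ)).const_mul c |>.const_sub 1
    simpa using ((((h 1).mul (h 2)).mul (h 3)).inv₀ (by norm_num)).const_mul (3 / 8)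
  refine tendsto_of_tendsto_of_tendsto_of_le_of_le' tendsto_const_nhds hlim ?_ ?_
  · filter_upwards [Filter.eventually_ge_atTop 4] with n hn
    have hpos : (0 : ℝ) < n.choose 4 := by exact_mod_cast Nat.choose_pos hn
    rw [le_div_iff₀ hpos]
    exact le_maxCopies_H31 n hn
  · filter_upwards [Filter.eventually_ge_atTop 4] with n hn
    have hpos : (0 : ℝ) < n.choose 4 := by exact_mod_cast Nat.choose_pos hn
    have hn' : (4 : ℝ) ≤ n := by exact_mod_cast hn
    rw [div_le_iff₀ hpos, cast_choose_four]
    refine (maxCopies_H31_le n).trans_eq ?_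
    have h0 : (n : ℝ) ≠ 0 := by linarith
    have h1 : (n : ℝ) - 1 ≠ 0 := by linarith
    have h2 : (n : ℝ) - 2 ≠ 0 := by linarith
    have h3 : (n : ℝ) - 3 ≠ 0 := by linarith
    have e (c : ℝ) : 1 - c * (n : ℝ)⁻¹ = (n - c) / n := by field_simp
    rw [e, e, e]
    field_simp
    norm_num
end

section
/- Let G be the oriented graph obtained from an arbitrary tournament T on t vertices and an independent set A on s vertices (disjoint from T) by adding an arc from every vertex of T to every vertex of A. Then the number of induced copies of H31 in G equals C(t,2)·C(s,2). -/
/-- The graph obtained from a tournament on `Fin t` and an independent set `Fin s`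
by adding all arcs from the tournament to the independent set. -/
def joinToAnticlique {t s : ℕ} (T : Fin t → Fin t → Prop) :
    Fin t ⊕ Fin s → Fin t ⊕ Fin s → Prop := fun x y =>
  match x, y with
  | Sum.inl a, Sum.inl b => T a b
  | Sum.inl _, Sum.inr _ => True
  | Sum.inr _, Sum.inl _ => False
  | Sum.inr _, Sum.inr _ => False

/-- The image of `![inl a, inl b, inr c, inr d]` is the disjoint sum of `{a, b}` and `{c, d}`. -/
lemma image_univ_eq_disjSum_pair {α β : Type} [DecidableEq α] [DecidableEq β]
    {f : Fin 4 → α ⊕ β} {a b : α} {c d : β} (h0 : f 0 = Sum.inl a) (h1 : f 1 = Sum.inl b)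
    (h2 : f 2 = Sum.inr c) (h3 : f 3 = Sum.inr d) :
    Finset.univ.image f = ({a, b} : Finset α).disjSum ({c, d} : Finset β) := by
  ext (x | x) <;> simp [Fin.exists_fin_succ, h0, h1, h2, h3, eq_comm]

/-- An induced embedding of `H31` sends its two sources into the tournament and its two
non-adjacent vertices into the independent set. -/
lemma disjSum_of_H31_embedding {t s : ℕ} {T : Fin t → Fin t → Prop}
    (hTtotal : ∀ u v : Fin t, u ≠ v → T u v ∨ T v u) {f : Fin 4 → Fin t ⊕ Fin s}
    (hf : Function.Injective f) (hadj : ∀ i j, H31 i j ↔ joinToAnticlique T (f i) (f j)) :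
    ∃ (A : Finset (Fin t)) (B : Finset (Fin s)), A.card = 2 ∧ B.card = 2 ∧
      Finset.univ.image f = A.disjSum B := by
  have h01 : f 0 ≠ f 1 := hf.ne (by decide)
  have h23 : f 2 ≠ f 3 := hf.ne (by decide)
  have a02 := hadj 0 2
  have a12 := hadj 1 2
  have a23 := hadj 2 3
  have a32 := hadj 3 2
  rcases h0 : f 0 with a | a <;> rcases h1 : f 1 with b | b <;>
    rcases h2 : f 2 with c | c <;> rcases h3 : f 3 with d | d <;>
    simp [H31, joinToAnticlique, h0, h1, h2, h3] at a02 a12 a23 a32 h01 h23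
  · rcases hTtotal c d h23 with h | h <;> contradiction
  · exact ⟨{a, b}, {c, d}, Finset.card_pair h01, Finset.card_pair h23,
      image_univ_eq_disjSum_pair h0 h1 h2 h3⟩

/-- An arc of the tournament and two vertices of the independent set span an induced `H31`. -/
lemma exists_H31_embedding_of_arc {t s : ℕ} {T : Fin t → Fin t → Prop}
    (hTasymm : ∀ u v, ¬ (T u v ∧ T v u)) {a b : Fin t} (hab : T a b) {c d : Fin s}
    (hcd : c ≠ d) :
    ∃ f : Fin 4 → Fin t ⊕ Fin s, Function.Injective f ∧
      Finset.univ.image f = ({a, b} : Finset (Fin t)).disjSum ({c, d} : Finset (Fin s)) ∧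
      ∀ i j, H31 i j ↔ joinToAnticlique T (f i) (f j) := by
  have hba : ¬ T b a := fun h => hTasymm a b ⟨hab, h⟩
  have hirr : ∀ u, ¬ T u u := fun u h => hTasymm u u ⟨h, h⟩
  have hne : a ≠ b := fun h => hirr b (h ▸ hab)
  refine ⟨![Sum.inl a, Sum.inl b, Sum.inr c, Sum.inr d], ?_,
    image_univ_eq_disjSum_pair rfl rfl rfl rfl, ?_⟩
  · intro i j
    fin_cases i <;> fin_cases j <;> simp [hne, hne.symm, hcd, hcd.symm]
  · intro i j
    fin_cases i <;> fin_cases j <;> simp [H31, joinToAnticlique, hab, hba, hirr]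

theorem stmt3 (t s : ℕ) (T : Fin t → Fin t → Prop)
    (hTasymm : ∀ u v, ¬ (T u v ∧ T v u))
    (hTtotal : ∀ u v : Fin t, u ≠ v → T u v ∨ T v u) :
    inducedCopies H31 (joinToAnticlique (s := s) T) =
      Nat.choose t 2 * Nat.choose s 2 := by
  have hcopies : {S : Finset (Fin t ⊕ Fin s) | ∃ f : Fin 4 → Fin t ⊕ Fin s,
      Function.Injective f ∧ Finset.univ.image f = S ∧
        ∀ i j, H31 i j ↔ joinToAnticlique T (f i) (f j)} =
      (fun p : Finset (Fin t) × Finset (Fin s) => p.1.disjSum p.2) ''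
        ((Finset.powersetCard 2 Finset.univ ×ˢ Finset.powersetCard 2 Finset.univ :
          Finset (Finset (Fin t) × Finset (Fin s))) : Set _) := by
    ext S
    constructor
    · rintro ⟨f, hf, rfl, hadj⟩
      obtain ⟨A, B, hA, hB, h⟩ := disjSum_of_H31_embedding hTtotal hf hadj
      exact ⟨(A, B), by simp [hA, hB], h.symm⟩
    · rintro ⟨⟨A, B⟩, hAB, rfl⟩
      simp only [Finset.coe_product, Set.mem_prod, Finset.mem_coe, Finset.mem_powersetCard,
        Finset.subset_univ, true_and] at hAB
      obtain ⟨a, b, hab, rfl⟩ := Finset.card_eq_two.mp hAB.1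
      obtain ⟨c, d, hcd, rfl⟩ := Finset.card_eq_two.mp hAB.2
      rcases hTtotal a b hab with h | h
      · exact exists_H31_embedding_of_arc hTasymm h hcd
      · rw [Finset.pair_comm a b]
        exact exists_H31_embedding_of_arc hTasymm h hcd
  have hinj : Function.Injective
      (fun p : Finset (Fin t) × Finset (Fin s) => p.1.disjSum p.2) := by
    rintro ⟨A, B⟩ ⟨A', B'⟩ h
    simpa using And.intro (congrArg Finset.toLeft h) (congrArg Finset.toRight h)
  rw [inducedCopies, hcopies, Set.ncard_image_of_injective _ hinj, Set.ncard_coe_finset,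
    Finset.card_product, Finset.card_powersetCard, Finset.card_powersetCard, Finset.card_fin,
    Finset.card_fin]
end

section
/- For every oriented graph G on n vertices, 54·N(H33, G) ≤ n·(n−1)³. -/
/-- The oriented graph on 4 vertices with arcs 1→3, 2→3, 3→4, 4→1, 4→2
(vertices 1 and 2 non-adjacent), here on `Fin 4` as 0→2, 1→2, 2→3, 3→0, 3→1. -/
def H33 : Fin 4 → Fin 4 → Prop := fun i j =>
  (i = 0 ∧ j = 2) ∨ (i = 1 ∧ j = 2) ∨ (i = 2 ∧ j = 3) ∨ (i = 3 ∧ j = 0) ∨ (i = 3 ∧ j = 1)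

theorem mul_mul_le_cube_add_add (a b c : ℕ) : 27 * (a * b * c) ≤ (a + b + c) ^ 3 := by
  zify
  have ha : (0 : ℤ) ≤ a := by positivity
  have hb : (0 : ℤ) ≤ b := by positivity
  have hc : (0 : ℤ) ≤ c := by positivity
  nlinarith [mul_nonneg ha (sq_nonneg ((b : ℤ) - c)), mul_nonneg hb (sq_nonneg ((a : ℤ) - c)),
    mul_nonneg hc (sq_nonneg ((a : ℤ) - b)), mul_nonneg ha (sq_nonneg ((a : ℤ) - b)),
    mul_nonneg ha (sq_nonneg ((a : ℤ) - c)), mul_nonneg hb (sq_nonneg ((b : ℤ) - a)),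
    mul_nonneg hb (sq_nonneg ((b : ℤ) - c)), mul_nonneg hc (sq_nonneg ((c : ℤ) - a)),
    mul_nonneg hc (sq_nonneg ((c : ℤ) - b))]

section Embeddings

open Classical in
/-- The induced embeddings of `H` into `G`. -/
noncomputable def inducedEmbeddings {k : ℕ} (H : Fin k → Fin k → Prop) {V : Type}
    [Fintype V] (G : V → V → Prop) : Finset (Fin k → V) :=
  {f | Function.Injective f ∧ ∀ i j, H i j ↔ G (f i) (f j)}

theorem mem_inducedEmbeddings {k : ℕ} {H : Fin k → Fin k → Prop} {V : Type}
    [Fintype V] {G : V → V → Prop} {f : Fin k → V} :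
    f ∈ inducedEmbeddings H G ↔ Function.Injective f ∧ ∀ i j, H i j ↔ G (f i) (f j) := by
  simp [inducedEmbeddings]

theorem inducedCopies_eq_card_image {k : ℕ} (H : Fin k → Fin k → Prop) {V : Type}
    [Fintype V] [DecidableEq V] (G : V → V → Prop) :
    inducedCopies H G =
      ((inducedEmbeddings H G).image fun f => Finset.univ.image f).card := by
  rw [inducedCopies, ← Set.ncard_coe_finset]
  congr 1
  ext S
  simp [mem_inducedEmbeddings, and_left_comm, and_comm]

variable {V : Type} [Fintype V] [DecidableEq V]

/-- Exchanging the two non-adjacent vertices of `H33` gives a second embedding with the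
same image. -/
theorem two_mul_inducedCopies_H33_le (G : V → V → Prop) :
    2 * inducedCopies H33 G ≤ (inducedEmbeddings H33 G).card := by
  rw [inducedCopies_eq_card_image]
  refine Finset.mul_card_image_le_card _ 2 fun S hS => ?_
  obtain ⟨f, hf, rfl⟩ := Finset.mem_image.1 hS
  have hf' := mem_inducedEmbeddings.1 hf
  have hswap : ∀ i j, H33 (Equiv.swap 0 1 i) (Equiv.swap 0 1 j) ↔ H33 i j := by
    unfold H33
    decide
  have hg : f ∘ Equiv.swap 0 1 ∈ inducedEmbeddings H33 G :=
    mem_inducedEmbeddings.2 ⟨hf'.1.comp (Equiv.injective _), fun i j => by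
      rw [← hswap, hf'.2]; rfl⟩
  have hne : f ≠ f ∘ Equiv.swap 0 1 := fun h => by
    have := hf'.1 (congrFun h 0)
    simp at this
  rw [← Finset.card_pair hne]
  refine Finset.card_le_card fun g hgm => ?_
  rcases Finset.mem_insert.1 hgm with rfl | hgm
  · simp [hf]
  · rw [Finset.mem_singleton.1 hgm, Finset.mem_filter]
    refine ⟨hg, ?_⟩
    rw [← Finset.image_image, Finset.image_univ_equiv]

open Classical in
/-- Fixing the image `x` of the first vertex, the other three vertices lie among the
non-neighbours, the out-neighbours and the in-neighbours of `x`. -/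
theorem card_inducedEmbeddings_H33_le (G : V → V → Prop) (hG : ∀ u v, ¬ (G u v ∧ G v u)) :
    27 * (inducedEmbeddings H33 G).card ≤ Fintype.card V * (Fintype.card V - 1) ^ 3 := by
  let A : V → Finset V := fun x => {y | G x y}
  let B : V → Finset V := fun x => {y | G y x}
  let C : V → Finset V := fun x => {y | y ≠ x ∧ ¬ G x y ∧ ¬ G y x}
  have hcard : (inducedEmbeddings H33 G).card ≤
      (Finset.univ.sigma fun x => (A x ×ˢ B x) ×ˢ C x).card := by
    refine Finset.card_le_card_of_injOn (fun f => ⟨f 0, (f 2, f 3), f 1⟩) ?_ ?_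
    · intro f hf
      obtain ⟨hinj, h⟩ := mem_inducedEmbeddings.1 hf
      have h1 : f 1 ≠ f 0 := hinj.ne (by decide)
      simp [A, B, C, ← h, h1, H33]
    · intro f _ g _ h
      simp only [Sigma.mk.injEq, heq_eq_eq, Prod.mk.injEq] at h
      funext i
      fin_cases i <;> simp [h]
  have hdeg (x : V) : (A x).card + (B x).card + (C x).card ≤ Fintype.card V - 1 := by
    have hAB : Disjoint (A x) (B x) := by
      simp only [Finset.disjoint_left, A, B, Finset.mem_filter_univ]
      exact fun y h h' => hG _ _ ⟨h, h'⟩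
    have hABC : Disjoint (A x ∪ B x) (C x) := by
      simp only [Finset.disjoint_left, A, B, C, Finset.mem_filter_univ, Finset.mem_union]
      tauto
    rw [← Finset.card_union_of_disjoint hAB, ← Finset.card_union_of_disjoint hABC,
      ← Finset.card_univ, ← Finset.card_erase_of_mem (Finset.mem_univ x)]
    refine Finset.card_le_card fun y hy => ?_
    simp only [A, B, C, Finset.mem_filter_univ, Finset.mem_union] at hy
    rw [Finset.mem_erase]
    refine ⟨?_, Finset.mem_univ y⟩
    rintro rfl
    have := hG y y
    tauto
  calc 27 * (inducedEmbeddings H33 G).card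
      ≤ ∑ x, 27 * ((A x).card * (B x).card * (C x).card) := by
        rw [← Finset.mul_sum]
        simpa [Finset.card_sigma, Finset.card_product] using hcard
    _ ≤ ∑ _x : V, (Fintype.card V - 1) ^ 3 :=
        Finset.sum_le_sum fun x _ =>
          (mul_mul_le_cube_add_add _ _ _).trans (Nat.pow_le_pow_left (hdeg x) 3)
    _ = Fintype.card V * (Fintype.card V - 1) ^ 3 := by simp

end Embeddings

theorem stmt5 (n : ℕ) (G : Fin n → Fin n → Prop) (hG : ∀ u v, ¬ (G u v ∧ G v u)) :
    54 * inducedCopies H33 G ≤ n * (n - 1) ^ 3 := by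
  have h₁ := two_mul_inducedCopies_H33_le G
  have h₂ := card_inducedEmbeddings_H33_le G hG
  rw [Fintype.card_fin] at h₂
  omega
end

section
/- For every tournament T on k vertices, 24·c3(T) ≤ (k−1)·k·(k+1), where c3(T) denotes the number of 3-element vertex subsets of T that induce a directed 3-cycle. -/
/-- The number of 3-element vertex subsets inducing a directed 3-cycle. -/
noncomputable def cyclicTriples {V : Type} [Fintype V] [DecidableEq V]
    (T : V → V → Prop) : ℕ :=
  Set.ncard {S : Finset V | ∃ u v w : V, S = {u, v, w} ∧ u ≠ v ∧ v ≠ w ∧ u ≠ w ∧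
    T u v ∧ T v w ∧ T w u}

open Classical in
/-- The ordered triples `(u, v, w)` with arcs `u → v → w → u`. -/
noncomputable def orderedCyclicTriples {V : Type} [Fintype V] (T : V → V → Prop) :
    Finset (V × V × V) :=
  Finset.univ.filter fun p => T p.1 p.2.1 ∧ T p.2.1 p.2.2 ∧ T p.2.2 p.1

theorem three_mul_cyclicTriples_le {V : Type} [Fintype V] [DecidableEq V] (T : V → V → Prop)
    (hT : ∀ u v, ¬ (T u v ∧ T v u)) :
    3 * cyclicTriples T ≤ (orderedCyclicTriples T).card := by
  classical
  set C : Finset (Finset V) := Finset.univ.filter fun S => ∃ u v w : V,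
    S = {u, v, w} ∧ u ≠ v ∧ v ≠ w ∧ u ≠ w ∧ T u v ∧ T v w ∧ T w u with hC
  have hcard : cyclicTriples T = C.card := by
    rw [cyclicTriples, ← Set.ncard_coe_finset]
    simp [hC]
  have hirr : ∀ u, ¬ T u u := fun u h => hT u u ⟨h, h⟩
  have hmaps : ∀ p ∈ orderedCyclicTriples T, ({p.1, p.2.1, p.2.2} : Finset V) ∈ C := by
    rintro ⟨u, v, w⟩ h
    simp only [orderedCyclicTriples, Finset.mem_filter, Finset.mem_univ, true_and] at h
    obtain ⟨huv, hvw, hwu⟩ := h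
    simp only [hC, Finset.mem_filter, Finset.mem_univ, true_and]
    exact ⟨u, v, w, rfl, fun e => hirr _ (e ▸ huv), fun e => hirr _ (e ▸ hvw),
      fun e => hirr _ (e ▸ hwu), huv, hvw, hwu⟩
  rw [hcard, Finset.card_eq_sum_card_fiberwise hmaps, mul_comm, ← smul_eq_mul]
  refine Finset.card_nsmul_le_sum _ _ _ fun S hS => ?_
  simp only [hC, Finset.mem_filter, Finset.mem_univ, true_and] at hS
  obtain ⟨u, v, w, rfl, huv, hvw, huw, h₁, h₂, h₃⟩ := hS
  have hthree : ({(u, v, w), (v, w, u), (w, u, v)} : Finset (V × V × V)).card = 3 :=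
    Finset.card_eq_three.2 ⟨_, _, _, by simp [huv], by simp [huw], by simp [hvw], rfl⟩
  rw [← hthree]
  refine Finset.card_le_card fun p hp => ?_
  simp only [Finset.mem_insert, Finset.mem_singleton] at hp
  simp only [orderedCyclicTriples, Finset.mem_filter, Finset.mem_univ, true_and]
  rcases hp with rfl | rfl | rfl
  · exact ⟨⟨h₁, h₂, h₃⟩, rfl⟩
  · exact ⟨⟨h₂, h₃, h₁⟩, by ext; simp; tauto⟩
  · exact ⟨⟨h₃, h₁, h₂⟩, by ext; simp; tauto⟩

/-- With `b u v = 1`, `-1`, `0` for `u → v`, `v → u`, `u = v`, summing over all triples gives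
`8 * #(ordered cyclic triples) + 3 * ∑ u, (∑ v, b u v) ^ 2 = n ^ 3 - n`. -/
theorem eight_mul_card_orderedCyclicTriples_le {V : Type} [Fintype V] (T : V → V → Prop)
    (hT : ∀ u v, ¬ (T u v ∧ T v u)) (hT' : ∀ u v, u ≠ v → T u v ∨ T v u) :
    8 * ((orderedCyclicTriples T).card : ℤ) ≤ (Fintype.card V : ℤ) ^ 3 - Fintype.card V := by
  classical
  set b : V → V → ℤ := fun u v => (if T u v then 1 else 0) - (if T v u then 1 else 0) with hb
  set c : V → V → V → ℤ := fun u v w => if T u v ∧ T v w ∧ T w u then 1 else 0 with hc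
  have hirr : ∀ u, ¬ T u u := fun u h => hT u u ⟨h, h⟩
  have hpoint : ∀ u v w, 4 * c u v w + 4 * c u w v +
      (b u v * b u w + b v u * b v w + b w u * b w v) =
      1 - if u = v then (if u = w then 1 else 0) else 0 := by
    intro u v w
    have h₁ := hT u v
    have h₂ := hT v w
    have h₃ := hT u w
    have h₁' := hT' u v
    have h₂' := hT' v w
    have h₃' := hT' u w
    simp only [hb, hc]
    by_cases euv : u = v
    · subst euv
      by_cases euw : u = w
      · subst euw
        simp [hirr]
      · by_cases x : T u w <;> by_cases y : T w u <;> simp_all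
    · by_cases euw : u = w
      · subst euw
        by_cases x : T u v <;> by_cases y : T v u <;> simp_all
      · by_cases evw : v = w
        · subst evw
          by_cases x : T u v <;> by_cases y : T v u <;> simp_all
        · by_cases x : T u v <;> by_cases x' : T v u <;> by_cases y : T v w <;>
            by_cases y' : T w v <;> by_cases z : T u w <;> by_cases z' : T w u <;> simp_all
  have hcard : ((orderedCyclicTriples T).card : ℤ) = ∑ u, ∑ v, ∑ w, c u v w := by
    simp only [orderedCyclicTriples, Finset.card_filter, Fintype.sum_prod_type, hc]
    push_cast
    rfl
  have hcard' : ∑ u, ∑ v, ∑ w, c u w v = ∑ u, ∑ v, ∑ w, c u v w :=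
    Finset.sum_congr rfl fun u _ => Finset.sum_comm
  have hsq : ∑ u, ∑ v, ∑ w, b u v * b u w = ∑ u, (∑ v, b u v) ^ 2 := by
    simp only [sq, Finset.sum_mul_sum]
  have hsq₁ : ∑ u, ∑ v, ∑ w, b v u * b v w = ∑ u, (∑ v, b u v) ^ 2 := by
    rw [Finset.sum_comm, hsq]
  have hsq₂ : ∑ u, ∑ v, ∑ w, b w u * b w v = ∑ u, (∑ v, b u v) ^ 2 := by
    rw [← hsq, Finset.sum_congr rfl fun u _ => Finset.sum_comm, Finset.sum_comm]
  have hsum := Finset.sum_congr (rfl : (Finset.univ : Finset V) = _) fun u _ =>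
    Finset.sum_congr (rfl : (Finset.univ : Finset V) = _) fun v _ =>
      Finset.sum_congr (rfl : (Finset.univ : Finset V) = _) fun w _ => hpoint u v w
  have hright : ∑ u : V, ∑ v : V, ∑ w : V,
      ((1 : ℤ) - if u = v then (if u = w then 1 else 0) else 0) =
      (Fintype.card V : ℤ) ^ 3 - Fintype.card V := by
    have hdiag : ∀ u v : V, ∑ w : V, (if u = v then (if u = w then (1 : ℤ) else 0) else 0) =
        if u = v then 1 else 0 := by
      intro u v
      split_ifs <;> simp
    simp only [Finset.sum_sub_distrib, hdiag]
    simp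
    ring
  rw [hright] at hsum
  have hscale : ∀ f : V → V → V → ℤ,
      ∑ u, ∑ v, ∑ w, 4 * f u v w = 4 * ∑ u, ∑ v, ∑ w, f u v w := fun f => by
    simp only [Finset.mul_sum]
  simp only [Finset.sum_add_distrib] at hsum
  rw [hscale c, hscale fun u v w => c u w v, hcard', hsq, hsq₁, hsq₂] at hsum
  have hnonneg : 0 ≤ ∑ u, (∑ v, b u v) ^ 2 := Finset.sum_nonneg fun u _ => sq_nonneg _
  linarith

theorem stmt9 (k : ℕ) (T : Fin k → Fin k → Prop)
    (hTasymm : ∀ u v, ¬ (T u v ∧ T v u))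
    (hTtotal : ∀ u v : Fin k, u ≠ v → T u v ∨ T v u) :
    24 * cyclicTriples T ≤ (k - 1) * k * (k + 1) := by
  have h₁ := three_mul_cyclicTriples_le T hTasymm
  have h₂ := eight_mul_card_orderedCyclicTriples_le T hTasymm hTtotal
  rw [Fintype.card_fin] at h₂
  rcases k with _ | n
  · simp at h₂ ⊢
    omega
  · zify at h₁ ⊢
    push_cast [Nat.add_sub_cancel] at h₂ ⊢
    linarith
end

section
/- For every oriented graph G on n vertices, 48·N(W, G) ≤ n²·(n−1)·(n−2). -/
/-- The strongly connected tournament on 4 vertices, with arcs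
1→2, 2→3, 3→4, 4→1, 1→3, 2→4, here on `Fin 4` as 0→1, 1→2, 2→3, 3→0, 0→2, 1→3. -/
def W : Fin 4 → Fin 4 → Prop := fun i j =>
  (i = 0 ∧ j = 1) ∨ (i = 1 ∧ j = 2) ∨ (i = 2 ∧ j = 3) ∨ (i = 3 ∧ j = 0) ∨
    (i = 0 ∧ j = 2) ∨ (i = 1 ∧ j = 3)

open Classical in
/-- The `0`-`1` indicator of the arc relation. -/
noncomputable def arcInd {V : Type} (G : V → V → Prop) (u v : V) : ℤ := if G u v then 1 else 0

/-- The indicator of the directed triangle `x → y → z → x`. -/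
noncomputable def triInd {V : Type} (G : V → V → Prop) (x y z : V) : ℤ :=
  arcInd G x y * arcInd G y z * arcInd G z x

/-- The indicator of an ordered copy of `W` on `a`, `b`, `c`, `d`. -/
noncomputable def wInd {V : Type} (G : V → V → Prop) (a b c d : V) : ℤ :=
  arcInd G a b * arcInd G b c * arcInd G c d * arcInd G d a * arcInd G a c * arcInd G b d

section

variable {V : Type} {G : V → V → Prop}

lemma triInd_nonneg (x y z : V) : 0 ≤ triInd G x y z := by
  unfold triInd arcInd
  split_ifs <;> norm_num

lemma triInd_rotate (x y z : V) : triInd G y z x = triInd G x y z := by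
  unfold triInd
  ring

lemma arcInd_eq (hG : ∀ u v, ¬ (G u v ∧ G v u)) (u v : V) :
    (arcInd G u v = 0 ∧ arcInd G v u = 0) ∨ (arcInd G u v = 1 ∧ arcInd G v u = 0) ∨
      (arcInd G u v = 0 ∧ arcInd G v u = 1) := by
  have := hG u v
  unfold arcInd
  split_ifs <;> simp_all

lemma arcInd_self (hG : ∀ u v, ¬ (G u v ∧ G v u)) (u : V) : arcInd G u u = 0 := by
  have := hG u u
  simp_all [arcInd]

/-- A vertex `v` extends a directed triangle to a copy of `W` in at most one way, and only if it
is not on the triangle. -/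
lemma sum_rotations_le [DecidableEq V] (hG : ∀ u v, ¬ (G u v ∧ G v u)) (x y z v : V) :
    wInd G x y v z + wInd G x v y z + (wInd G y z v x + wInd G y v z x) +
      (wInd G z x v y + wInd G z v x y) ≤
    triInd G x y z * (1 - (if v = x then 1 else 0) - (if v = y then 1 else 0) -
      (if v = z then 1 else 0)) := by
  have hself := arcInd_self hG
  by_cases hx : v = x
  · subst hx
    by_cases hy : v = y
    · subst hy; simp [wInd, triInd, hself]
    by_cases hz : v = z
    · subst hz; simp [wInd, triInd, hself]
    simp [wInd, hself, hy, hz]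
  by_cases hy : v = y
  · subst hy
    by_cases hz : v = z
    · subst hz; simp [wInd, triInd, hself]
    simp [wInd, hself, hx, hz]
  by_cases hz : v = z
  · subst hz; simp [wInd, hself, hx, hy]
  simp only [hx, hy, hz, if_false, sub_zero, mul_one]
  unfold wInd triInd
  rcases arcInd_eq hG x v with ⟨h1, h2⟩ | ⟨h1, h2⟩ | ⟨h1, h2⟩ <;>
  rcases arcInd_eq hG y v with ⟨h3, h4⟩ | ⟨h3, h4⟩ | ⟨h3, h4⟩ <;>
  rcases arcInd_eq hG z v with ⟨h5, h6⟩ | ⟨h5, h6⟩ | ⟨h5, h6⟩ <;>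
  simp only [h1, h2, h3, h4, h5, h6, mul_zero, zero_mul, mul_one, add_zero, zero_add] <;>
  first
  | exact triInd_nonneg x y z
  | (apply le_of_eq; ring)

/-- Among the products of signed arcs at the three corners of a triple, a directed triangle
contributes `-3`, and every other triple at most `1`. -/
lemma signed_corners_le [DecidableEq V] (hG : ∀ u v, ¬ (G u v ∧ G v u)) (x y z : V) :
    (arcInd G x y - arcInd G y x) * (arcInd G x z - arcInd G z x) +
      (arcInd G y z - arcInd G z y) * (arcInd G y x - arcInd G x y) +
      (arcInd G z x - arcInd G x z) * (arcInd G z y - arcInd G y z) ≤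
    1 - (if x = y then if x = z then 1 else 0 else 0) -
      4 * (triInd G x y z + triInd G x z y) := by
  have hself := arcInd_self hG
  by_cases hxy : x = y
  · subst hxy
    by_cases hz : x = z
    · subst hz; simp [triInd, hself]
    simp only [triInd, hself, hz, if_true, if_false]
    rcases arcInd_eq hG x z with ⟨h1, h2⟩ | ⟨h1, h2⟩ | ⟨h1, h2⟩ <;> simp [h1, h2]
  simp only [hxy, if_false, triInd]
  rcases arcInd_eq hG x y with ⟨h1, h2⟩ | ⟨h1, h2⟩ | ⟨h1, h2⟩ <;>
  rcases arcInd_eq hG y z with ⟨h3, h4⟩ | ⟨h3, h4⟩ | ⟨h3, h4⟩ <;>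
  rcases arcInd_eq hG x z with ⟨h5, h6⟩ | ⟨h5, h6⟩ | ⟨h5, h6⟩ <;>
  norm_num [h1, h2, h3, h4, h5, h6]

variable [Fintype V]

lemma sum_rotate (F : V → V → V → ℤ) : ∑ x, ∑ y, ∑ z, F y z x = ∑ x, ∑ y, ∑ z, F x y z := by
  rw [Finset.sum_comm]
  exact Finset.sum_congr rfl fun _ _ => Finset.sum_comm

/-- An oriented graph on `n` vertices has at most `n (n² - 1) / 24` directed triangles. -/
lemma eight_mul_sum_triInd_le (hG : ∀ u v, ¬ (G u v ∧ G v u)) :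
    8 * ∑ x, ∑ y, ∑ z, triInd G x y z ≤ (Fintype.card V : ℤ) ^ 3 - Fintype.card V := by
  classical
  set s : V → V → ℤ := fun x y => arcInd G x y - arcInd G y x
  have hle : ∑ x, ∑ y, ∑ z, (s x y * s x z + s y z * s y x + s z x * s z y) ≤
      ∑ x, ∑ y, ∑ z, (1 - (if x = y then if x = z then 1 else 0 else 0) -
        4 * (triInd G x y z + triInd G x z y)) :=
    Finset.sum_le_sum fun x _ => Finset.sum_le_sum fun y _ => Finset.sum_le_sum fun z _ =>
      signed_corners_le hG x y z
  have hsq : 0 ≤ ∑ x, ∑ y, ∑ z, s x y * s x z := by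
    refine Finset.sum_nonneg fun x _ => ?_
    rw [← Finset.sum_mul_sum]
    exact mul_self_nonneg _
  have h1 : ∑ x, ∑ y, ∑ z, s y z * s y x = ∑ x, ∑ y, ∑ z, s x y * s x z :=
    sum_rotate fun x y z => s x y * s x z
  have h2 : ∑ x, ∑ y, ∑ z, s z x * s z y = ∑ x, ∑ y, ∑ z, s x y * s x z :=
    (sum_rotate fun x y z => s z x * s z y).symm.trans
      ((Finset.sum_congr rfl fun _ _ => Finset.sum_congr rfl fun _ _ =>
        Finset.sum_congr rfl fun _ _ => mul_comm _ _).trans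
      (by simp [mul_comm]))
  have h3 : ∑ x, ∑ y, ∑ z, triInd G x z y = ∑ x, ∑ y, ∑ z, triInd G x y z :=
    Finset.sum_congr rfl fun _ _ => Finset.sum_comm
  have h4 : ∑ x : V, ∑ y : V, ∑ z : V, (if x = y then if x = z then (1 : ℤ) else 0 else 0) =
      Fintype.card V := by
    simp
  simp only [Finset.sum_add_distrib, Finset.sum_sub_distrib, ← Finset.mul_sum, h1, h2, h3,
    h4] at hle
  simp only [Finset.sum_const, Finset.card_univ, nsmul_eq_mul, mul_one] at hle
  simp only [← Finset.mul_sum] at hsq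
  linarith

/-- Double counting of directed triangles inside copies of `W`. -/
lemma six_mul_sum_wInd_le (hG : ∀ u v, ¬ (G u v ∧ G v u)) :
    6 * ∑ a, ∑ b, ∑ c, ∑ d, wInd G a b c d ≤
      (∑ x, ∑ y, ∑ z, triInd G x y z) * ((Fintype.card V : ℤ) - 3) := by
  classical
  set F : V → V → V → ℤ := fun x y z => ∑ v, wInd G x y v z + ∑ v, wInd G x v y z with hF
  have hle : ∑ x, ∑ y, ∑ z, (F x y z + F y z x + F z x y) ≤
      ∑ x, ∑ y, ∑ z, triInd G x y z * ((Fintype.card V : ℤ) - 3) := by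
    refine Finset.sum_le_sum fun x _ => Finset.sum_le_sum fun y _ => Finset.sum_le_sum fun z _ => ?_
    have := Finset.sum_le_sum fun v (_ : v ∈ Finset.univ) => sum_rotations_le hG x y z v
    simp only [← Finset.mul_sum, Finset.sum_add_distrib, Finset.sum_sub_distrib,
      Finset.sum_ite_eq', Finset.mem_univ, if_true, Finset.sum_const, Finset.card_univ,
      nsmul_eq_mul, mul_one] at this
    simp only [hF]
    linarith
  have h1 : ∑ x, ∑ y, ∑ z, F y z x = ∑ x, ∑ y, ∑ z, F x y z := sum_rotate F
  have h2 : ∑ x, ∑ y, ∑ z, F z x y = ∑ x, ∑ y, ∑ z, F x y z :=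
    (sum_rotate fun x y z => F z x y).symm
  have h3 : ∑ x, ∑ y, ∑ z, ∑ v, wInd G x y v z = ∑ a, ∑ b, ∑ c, ∑ d, wInd G a b c d :=
    Finset.sum_congr rfl fun _ _ => Finset.sum_congr rfl fun _ _ => Finset.sum_comm
  have h4 : ∑ x, ∑ y, ∑ z, ∑ v, wInd G x v y z = ∑ a, ∑ b, ∑ c, ∑ d, wInd G a b c d :=
    Finset.sum_congr rfl fun x _ => (sum_rotate fun y z v => wInd G x v y z).symm
  have h5 : ∑ x, ∑ y, ∑ z, F x y z = 2 * ∑ a, ∑ b, ∑ c, ∑ d, wInd G a b c d := by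
    simp only [hF, Finset.sum_add_distrib, h3, h4]
    ring
  simp only [Finset.sum_add_distrib, h1, h2, h5, ← Finset.sum_mul] at hle
  linarith

lemma inducedCopies_W_le [DecidableEq V] :
    (inducedCopies W G : ℤ) ≤ ∑ a, ∑ b, ∑ c, ∑ d, wInd G a b c d := by
  classical
  set T : Finset (V × V × V × V) := Finset.univ.filter fun p =>
    G p.1 p.2.1 ∧ G p.2.1 p.2.2.1 ∧ G p.2.2.1 p.2.2.2 ∧ G p.2.2.2 p.1 ∧ G p.1 p.2.2.1 ∧
      G p.2.1 p.2.2.2 with hT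
  have hcard : (T.card : ℤ) = ∑ a, ∑ b, ∑ c, ∑ d, wInd G a b c d := by
    rw [hT, Finset.card_filter]
    simp only [Fintype.sum_prod_type]
    push_cast
    refine Finset.sum_congr rfl fun a _ => Finset.sum_congr rfl fun b _ =>
      Finset.sum_congr rfl fun c _ => Finset.sum_congr rfl fun d _ => ?_
    simp only [wInd, arcInd, ite_and]
    split_ifs <;> simp
  rw [← hcard, Nat.cast_le]
  refine le_trans ?_ (Finset.card_image_le (s := T)
    (f := fun p => ({p.1, p.2.1, p.2.2.1, p.2.2.2} : Finset V)))
  rw [← Set.ncard_coe_finset]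
  refine Set.ncard_le_ncard ?_ (Finset.finite_toSet _)
  rintro S ⟨f, -, rfl, hf⟩
  simp only [Finset.coe_image, Set.mem_image, Finset.mem_coe]
  refine ⟨(f 0, f 1, f 2, f 3), ?_, ?_⟩
  · simp [hT, ← hf, W]
  · ext v
    simp [Fin.exists_fin_succ, eq_comm]

end

theorem stmt11 (n : ℕ) (G : Fin n → Fin n → Prop)
    (hG : ∀ u v, ¬ (G u v ∧ G v u)) :
    48 * inducedCopies W G ≤ n ^ 2 * (n - 1) * (n - 2) := by
  have h1 := inducedCopies_W_le (G := G)
  have h2 := six_mul_sum_wInd_le hG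
  have h3 := eight_mul_sum_triInd_le hG
  have h4 : 0 ≤ ∑ x, ∑ y, ∑ z, triInd G x y z :=
    Finset.sum_nonneg fun x _ => Finset.sum_nonneg fun y _ => Finset.sum_nonneg fun z _ =>
      triInd_nonneg x y z
  rw [Fintype.card_fin] at h2 h3
  rcases le_total n 3 with hn | hn
  · have hn' : (n : ℤ) - 3 ≤ 0 := by
      have : (n : ℤ) ≤ 3 := by exact_mod_cast hn
      linarith
    have := mul_nonpos_of_nonneg_of_nonpos h4 hn'
    have h0 : inducedCopies W G = 0 := by omega
    simp [h0]
  · have hn' : (0 : ℤ) ≤ n - 3 := by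
      have : (3 : ℤ) ≤ n := by exact_mod_cast hn
      linarith
    zify [(by omega : 1 ≤ n), (by omega : 2 ≤ n)]
    have h5 := mul_le_mul_of_nonneg_right h3 hn'
    have h6 : (0 : ℤ) ≤ n * (n - 1) := mul_nonneg (by linarith) (by linarith)
    linarith
end

section
/- The inducibility of W equals 1/2; that is, the sequence a_n = (max{N(W,G) : G an oriented graph on n vertices}) / C(n,4) tends to 1/2 as n → ∞. -/
open Finset

section UpperBound

variable {V : Type} [Fintype V] {G : V → V → Prop}

/-- The arcs of `W` are present on the quadruple `p` in `G`. -/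
def IsWTuple (G : V → V → Prop) (p : V × V × V × V) : Prop :=
  G p.1 p.2.1 ∧ G p.2.1 p.2.2.1 ∧ G p.2.2.1 p.2.2.2 ∧ G p.2.2.2 p.1 ∧
    G p.1 p.2.2.1 ∧ G p.2.1 p.2.2.2

open Classical in
lemma inducedCopies_W_le_card [DecidableEq V] (G : V → V → Prop) :
    inducedCopies W G ≤ #{p : V × V × V × V | IsWTuple G p} := by
  let toSet : V × V × V × V → Finset V := fun p => {p.1, p.2.1, p.2.2.1, p.2.2.2}
  refine le_trans ?_ (card_image_le (f := toSet))
  rw [← Set.ncard_coe_finset]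
  refine Set.ncard_le_ncard ?_ (Finset.finite_toSet _)
  rintro S ⟨f, -, rfl, hf⟩
  simp only [coe_image, Set.mem_image, mem_coe, mem_filter, mem_univ, true_and]
  refine ⟨(f 0, f 1, f 2, f 3), ?_, ?_⟩
  · simp only [IsWTuple, ← hf]
    simp [W]
  · ext v
    simp [toSet, Fin.exists_fin_succ, eq_comm]

open Classical in
/-- Each copy of `W` contains two cyclic triangles. -/
lemma six_mul_card_isWTuple_le (hG : ∀ u v, ¬ (G u v ∧ G v u)) :
    6 * (#{p : V × V × V × V | IsWTuple G p} : ℤ) ≤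
      Fintype.card V * ∑ x, ∑ y, ∑ z, if G x y ∧ G y z ∧ G z x then (1 : ℤ) else 0 := by
  let e : V × V × V × V → ℤ := fun p => if IsWTuple G p then 1 else 0
  let c : V → V → V → ℤ := fun x y z => if G x y ∧ G y z ∧ G z x then 1 else 0
  have reindex (φ : Equiv.Perm (V × V × V × V)) : ∑ p, e (φ p) = ∑ p, e p := Equiv.sum_comp φ e
  have h₁ := reindex ⟨fun p => (p.1, p.2.1, p.2.2.2, p.2.2.1),
    fun p => (p.1, p.2.1, p.2.2.2, p.2.2.1), fun _ => rfl, fun _ => rfl⟩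
  have h₂ := reindex ⟨fun p => (p.2.1, p.2.2.1, p.2.2.2, p.1),
    fun p => (p.2.2.2, p.1, p.2.1, p.2.2.1), fun _ => rfl, fun _ => rfl⟩
  have h₃ := reindex ⟨fun p => (p.2.2.1, p.1, p.2.2.2, p.2.1),
    fun p => (p.2.1, p.2.2.2, p.1, p.2.2.1), fun _ => rfl, fun _ => rfl⟩
  have h₄ := reindex ⟨fun p => (p.1, p.2.2.2, p.2.1, p.2.2.1),
    fun p => (p.1, p.2.2.1, p.2.2.2, p.2.1), fun _ => rfl, fun _ => rfl⟩
  have h₅ := reindex ⟨fun p => (p.2.1, p.2.2.2, p.2.2.1, p.1),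
    fun p => (p.2.2.2, p.1, p.2.2.1, p.2.1), fun _ => rfl, fun _ => rfl⟩
  have h₆ := reindex ⟨fun p => (p.2.2.1, p.2.2.2, p.1, p.2.1),
    fun p => (p.2.2.1, p.2.2.2, p.1, p.2.1), fun _ => rfl, fun _ => rfl⟩
  simp only [Equiv.coe_fn_mk] at h₁ h₂ h₃ h₄ h₅ h₆
  have hcard : (#{p : V × V × V × V | IsWTuple G p} : ℤ) = ∑ p, e p := by
    simp [e]
  have hle : ∑ p : V × V × V × V, (e (p.1, p.2.1, p.2.2.2, p.2.2.1) +
      e (p.2.1, p.2.2.1, p.2.2.2, p.1) + e (p.2.2.1, p.1, p.2.2.2, p.2.1) +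
      e (p.1, p.2.2.2, p.2.1, p.2.2.1) + e (p.2.1, p.2.2.2, p.2.2.1, p.1) +
      e (p.2.2.1, p.2.2.2, p.1, p.2.1)) ≤
      ∑ p : V × V × V × V, c p.1 p.2.1 p.2.2.1 := by
    refine sum_le_sum ?_
    rintro ⟨x, y, z, d⟩ -
    have hx := hG x d
    have hy := hG y d
    have hz := hG z d
    simp only [e, c]
    by_cases hc : G x y ∧ G y z ∧ G z x
    · obtain ⟨hxy, hyz, hzx⟩ := hc
      by_cases G x d <;> by_cases G y d <;> by_cases G z d <;> simp_all [IsWTuple]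
      all_goals split_ifs <;> simp_all
    · rw [if_neg hc]
      iterate 6 rw [if_neg (fun h => hc (by simp only [IsWTuple] at h; tauto))]
      simp
  simp only [sum_add_distrib, h₁, h₂, h₃, h₄, h₅, h₆] at hle
  rw [hcard]
  calc 6 * ∑ p, e p ≤ _ := by linarith
    _ = Fintype.card V * ∑ x, ∑ y, ∑ z, c x y z := by
      simp only [Fintype.sum_prod_type, mul_sum]
      refine sum_congr rfl fun x _ => sum_congr rfl fun y _ => sum_congr rfl fun z _ => ?_
      rw [sum_const, card_univ, nsmul_eq_mul]

open Classical in
lemma eight_mul_sum_cyclic_le (hG : ∀ u v, ¬ (G u v ∧ G v u)) :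
    8 * (∑ x, ∑ y, ∑ z, if G x y ∧ G y z ∧ G z x then (1 : ℤ) else 0) ≤
      Fintype.card V ^ 3 := by
  let s : V → V → ℤ := fun x y => (if G x y then 1 else 0) - if G y x then 1 else 0
  let c : V → V → V → ℤ := fun x y z => if G x y ∧ G y z ∧ G z x then 1 else 0
  have hanti (x y) : s x y = - s y x := by simp [s]
  have hpt (x y z) : 4 * (c x y z + c z y x) ≤
      1 + (s x y * s y z + s y z * s z x + s z x * s x y) := by
    have h₁ := hG x y
    have h₂ := hG y z
    have h₃ := hG z x
    simp only [c, s]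
    by_cases G x y <;> by_cases G y x <;> by_cases G y z <;> by_cases G z y <;>
      by_cases G z x <;> by_cases G x z <;> simp_all
  have hrev : ∑ x, ∑ y, ∑ z, c z y x = ∑ x, ∑ y, ∑ z, c x y z := by
    rw [sum_comm, sum_congr rfl fun y _ => sum_comm, sum_comm]
  have hneg : ∑ y, ∑ x, ∑ z, s x y * s y z ≤ 0 := by
    refine sum_nonpos fun y _ => ?_
    rw [← sum_mul_sum, sum_congr rfl fun x _ => hanti x y, sum_neg_distrib]
    nlinarith [sq_nonneg (∑ x, s y x)]
  have hσ₁ : ∑ x, ∑ y, ∑ z, s x y * s y z ≤ 0 := by rwa [sum_comm]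
  have hσ₂ : ∑ x, ∑ y, ∑ z, s y z * s z x ≤ 0 := by
    rw [sum_comm, sum_congr rfl fun y _ => sum_comm]
    exact hσ₁
  have hσ₃ : ∑ x, ∑ y, ∑ z, s z x * s x y ≤ 0 := by
    rwa [sum_congr rfl fun x _ => sum_comm]
  have hsum := sum_le_sum fun x (_ : x ∈ univ) => sum_le_sum fun y (_ : y ∈ univ) =>
    sum_le_sum fun z (_ : z ∈ univ) => hpt x y z
  simp only [← mul_sum _ _ (4 : ℤ), sum_add_distrib, hrev] at hsum
  simp only [sum_const, card_univ, nsmul_eq_mul, mul_one] at hsum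
  change 8 * ∑ x, ∑ y, ∑ z, c x y z ≤ _
  linarith

lemma inducedCopies_W_mul_le [DecidableEq V] (hG : ∀ u v, ¬ (G u v ∧ G v u)) :
    48 * inducedCopies W G ≤ Fintype.card V ^ 4 := by
  classical
  have h₁ : (inducedCopies W G : ℤ) ≤ _ := Nat.cast_le.mpr (inducedCopies_W_le_card G)
  have h₂ := six_mul_card_isWTuple_le hG
  have h₃ := mul_le_mul_of_nonneg_left (eight_mul_sum_cyclic_le hG)
    (Nat.cast_nonneg (α := ℤ) (Fintype.card V))
  zify
  linarith

end UpperBound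

section LowerBound

/-- The tournament on `Fin n` in which `u < v` gives the arc `u → v` if `u` and `v` have the
same parity, and the arc `v → u` otherwise. -/
def parityTournament (n : ℕ) (u v : Fin n) : Prop :=
  (u < v ∧ u.val % 2 = v.val % 2) ∨ (v < u ∧ u.val % 2 ≠ v.val % 2)

lemma parityTournament_asymm {n : ℕ} (u v : Fin n) :
    ¬ (parityTournament n u v ∧ parityTournament n v u) := by
  simp only [parityTournament]
  grind

/-- The parity patterns for which an increasing quadruple of vertices of `parityTournament`
induces a copy of `W`. -/
def wParity : Fin 8 → Fin 4 → Fin 2 :=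
  ![![0, 0, 1, 0], ![0, 1, 0, 0], ![0, 1, 0, 1], ![0, 1, 1, 0],
    ![1, 0, 0, 1], ![1, 0, 1, 0], ![1, 0, 1, 1], ![1, 1, 0, 1]]

/-- The position in increasing order of each vertex of `W` in the copy given by `wParity`. -/
def wPosition : Fin 8 → Fin 4 → Fin 4 :=
  ![![2, 0, 1, 3], ![0, 2, 3, 1], ![1, 3, 0, 2], ![3, 1, 2, 0],
    ![3, 1, 2, 0], ![1, 3, 0, 2], ![0, 2, 3, 1], ![2, 0, 1, 3]]

lemma wParity_injective : Function.Injective wParity := by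
  decide

lemma wPosition_injective (k : Fin 8) : Function.Injective (wPosition k) := by
  revert k
  decide

lemma W_iff_wParity (k : Fin 8) (i j : Fin 4) : W i j ↔
    (wPosition k i < wPosition k j ∧
      wParity k (wPosition k i) = wParity k (wPosition k j)) ∨
    (wPosition k j < wPosition k i ∧
      wParity k (wPosition k i) ≠ wParity k (wPosition k j)) := by
  revert k i j
  unfold W
  decide

/-- Choose one vertex in each of four blocks `{2t, 2t + 1}`, following a parity pattern. -/
def blockChoice {n : ℕ} (t : Fin 4 ↪o Fin (n / 2)) (p : Fin 4 → Fin 2) (i : Fin 4) : Fin n :=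
  ⟨2 * (t i).val + (p i).val, by omega⟩

lemma blockChoice_strictMono {n : ℕ} (t : Fin 4 ↪o Fin (n / 2)) (p : Fin 4 → Fin 2) :
    StrictMono (blockChoice t p) := by
  intro i j hij
  have h : t i < t j := t.strictMono hij
  simp only [blockChoice, Fin.lt_def] at h ⊢
  omega

lemma parityTournament_blockChoice_iff {n : ℕ} (t : Fin 4 ↪o Fin (n / 2)) (p : Fin 4 → Fin 2)
    (i j : Fin 4) : parityTournament n (blockChoice t p i) (blockChoice t p j) ↔
      (i < j ∧ p i = p j) ∨ (j < i ∧ p i ≠ p j) := by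
  have hpar : (blockChoice t p i).val % 2 = (blockChoice t p j).val % 2 ↔ p i = p j := by
    rw [Fin.ext_iff]
    simp only [blockChoice]
    omega
  simp only [parityTournament, (blockChoice_strictMono t p).lt_iff_lt, ne_eq, hpar]

lemma eight_mul_choose_le_inducedCopies (n : ℕ) :
    8 * (n / 2).choose 4 ≤ inducedCopies W (parityTournament n) := by
  classical
  let F : (Fin 4 ↪o Fin (n / 2)) × Fin 8 → Finset (Fin n) :=
    fun q => univ.image (blockChoice q.1 (wParity q.2))
  have hF : Function.Injective F := by
    rintro ⟨t, k⟩ ⟨t', k'⟩ h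
    have hrange : Set.range (blockChoice t (wParity k)) =
        Set.range (blockChoice t' (wParity k')) := by
      simpa [F] using congrArg (fun S : Finset (Fin n) => (S : Set (Fin n))) h
    rw [(blockChoice_strictMono t _).range_inj (blockChoice_strictMono t' _)] at hrange
    have hval (i : Fin 4) : 2 * (t i).val + (wParity k i).val =
        2 * (t' i).val + (wParity k' i).val := congrArg Fin.val (congrFun hrange i)
    refine Prod.ext ?_ (wParity_injective ?_)
    · ext i
      have := hval i
      dsimp only
      omega
    · ext i
      have := hval i
      dsimp only
      omega
  have hcard : Nat.card ((Fin 4 ↪o Fin (n / 2)) × Fin 8) = 8 * (n / 2).choose 4 := by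
    rw [Nat.card_prod, Nat.card_congr Set.powersetCard.ofFinEmbEquiv, Set.powersetCard.card]
    simp [mul_comm]
  rw [← hcard, ← Set.ncard_univ, ← Set.ncard_image_of_injective _ hF]
  refine Set.ncard_le_ncard ?_ (Set.toFinite _)
  rintro _ ⟨⟨t, k⟩, -, rfl⟩
  have hinj := wPosition_injective k
  refine ⟨blockChoice t (wParity k) ∘ wPosition k,
    (blockChoice_strictMono t _).injective.comp hinj, ?_, fun i j => ?_⟩
  · rw [← image_image, image_univ_of_surjective (Finite.surjective_of_injective hinj)]
  · rw [Function.comp_apply, Function.comp_apply, parityTournament_blockChoice_iff]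
    exact W_iff_wParity k i j

end LowerBound

lemma maxCopies_W_mul_le (n : ℕ) : 48 * maxCopies W n ≤ n ^ 4 := by
  rw [mul_comm, ← Nat.le_div_iff_mul_le (by norm_num)]
  refine csSup_le ⟨_, parityTournament n, parityTournament_asymm, rfl⟩ ?_
  rintro _ ⟨G, hG, rfl⟩
  rw [Nat.le_div_iff_mul_le (by norm_num), mul_comm]
  simpa using inducedCopies_W_mul_le hG

lemma eight_mul_choose_le_maxCopies_W (n : ℕ) : 8 * (n / 2).choose 4 ≤ maxCopies W n := by
  refine (eight_mul_choose_le_inducedCopies n).trans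
    (le_csSup ⟨n ^ 4, ?_⟩ ⟨_, parityTournament_asymm, rfl⟩)
  rintro _ ⟨G, hG, rfl⟩
  have := inducedCopies_W_mul_le hG
  rw [Fintype.card_fin] at this
  omega

lemma sub_seven_pow_le_maxCopies_W {n : ℕ} (hn : 8 ≤ n) :
    ((n : ℝ) - 7) ^ 4 ≤ 48 * maxCopies W n := by
  have h₁ : (8 * (n / 2).choose 4 : ℝ) ≤ maxCopies W n := by
    exact_mod_cast eight_mul_choose_le_maxCopies_W n
  have h₂ := Nat.pow_le_choose (α := ℝ) 4 (n / 2)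
  have h₃ : (n : ℝ) - 7 ≤ 2 * ((n / 2 + 1 - 4 : ℕ) : ℝ) := by
    rw [sub_le_iff_le_add]
    exact_mod_cast (by omega : n ≤ 2 * (n / 2 + 1 - 4) + 7)
  have h₄ : (0 : ℝ) ≤ n - 7 := by
    have : (8 : ℝ) ≤ n := by exact_mod_cast hn
    linarith
  have h₅ := pow_le_pow_left₀ h₄ h₃ 4
  rw [mul_pow] at h₅
  norm_num [Nat.factorial] at h₂ h₅
  linarith

theorem stmt12 :
    Filter.Tendsto (fun n : ℕ => (maxCopies W n : ℝ) / (Nat.choose n 4 : ℝ))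
      Filter.atTop (nhds (1 / 2)) := by
  have hlow : Filter.Tendsto (fun n : ℕ => (1 - 7 / (n : ℝ)) ^ 4 / 2) Filter.atTop
      (nhds (1 / 2)) := by
    have h := ((tendsto_const_nhds (x := (1 : ℝ))).sub
      (tendsto_const_div_atTop_nhds_zero_nat (7 : ℝ))).pow 4
    simpa using h.div_const 2
  have hupp : Filter.Tendsto (fun n : ℕ => ((1 - 3 / (n : ℝ)) ^ 4)⁻¹ / 2) Filter.atTop
      (nhds (1 / 2)) := by
    have h := ((tendsto_const_nhds (x := (1 : ℝ))).sub
      (tendsto_const_div_atTop_nhds_zero_nat (3 : ℝ))).pow 4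
    simpa using (h.inv₀ (by norm_num)).div_const 2
  refine tendsto_of_tendsto_of_tendsto_of_le_of_le' hlow hupp ?_ ?_
  all_goals
    filter_upwards [Filter.eventually_ge_atTop 8] with n hn
    have hn' : (8 : ℝ) ≤ n := by exact_mod_cast hn
    have hn0 : (0 : ℝ) < n := by linarith
    have hchoose : (0 : ℝ) < n.choose 4 := by exact_mod_cast Nat.choose_pos (by omega)
  · have h₁ := sub_seven_pow_le_maxCopies_W hn
    have h₂ := Nat.choose_le_pow_div (α := ℝ) 4 n
    norm_num [Nat.factorial] at h₂
    have h₃ : (1 - 7 / (n : ℝ)) ^ 4 = (n - 7) ^ 4 / n ^ 4 := by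
      rw [← div_pow, sub_div, div_self hn0.ne']
    rw [h₃, le_div_iff₀ hchoose]
    calc ((n : ℝ) - 7) ^ 4 / n ^ 4 / 2 * n.choose 4
        ≤ ((n : ℝ) - 7) ^ 4 / n ^ 4 / 2 * (n ^ 4 / 24) := by gcongr
      _ = ((n : ℝ) - 7) ^ 4 / 48 := by field_simp; ring
      _ ≤ maxCopies W n := by linarith
  · have h₁ : (48 * maxCopies W n : ℝ) ≤ n ^ 4 := by exact_mod_cast maxCopies_W_mul_le n
    have h₂ := Nat.pow_le_choose (α := ℝ) 4 n
    have hsub : ((n + 1 - 4 : ℕ) : ℝ) = n - 3 := by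
      rw [Nat.cast_sub (by omega)]
      push_cast
      ring
    rw [hsub] at h₂
    norm_num [Nat.factorial] at h₂
    have hpos : (0 : ℝ) < (n - 3 : ℝ) := by linarith
    have h₃ : ((1 - 3 / (n : ℝ)) ^ 4)⁻¹ = (n : ℝ) ^ 4 / (n - 3) ^ 4 := by
      rw [← inv_div ((_ : ℝ) ^ 4), ← div_pow, sub_div, div_self hn0.ne']
    rw [h₃, div_le_iff₀ hchoose]
    calc (maxCopies W n : ℝ) ≤ n ^ 4 / 48 := by linarith
      _ = (n : ℝ) ^ 4 / (n - 3) ^ 4 / 2 * ((n - 3) ^ 4 / 24) := by field_simp; ring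
      _ ≤ (n : ℝ) ^ 4 / (n - 3) ^ 4 / 2 * n.choose 4 := by gcongr
end

section
/- The supremum of the function f(x) = 32·(1−2x)·x³ / (1 − (1−2x)⁴) over x in the open interval (0, 1/2) equals 4 − 6/(√2 − 1)^{1/3} + 6·(√2 − 1)^{1/3}. -/
/-- For `u = √2 - 1`, Cardano's formula gives `u ^ (-1/3) - u ^ (1/3)` as a root of
`X ^ 3 + 3 X - 2`. -/
theorem cardano_sqrt_two_sub_one :
    (1 / (Real.sqrt 2 - 1) ^ ((1 : ℝ) / 3) - (Real.sqrt 2 - 1) ^ ((1 : ℝ) / 3)) ^ 3 +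
      3 * (1 / (Real.sqrt 2 - 1) ^ ((1 : ℝ) / 3) - (Real.sqrt 2 - 1) ^ ((1 : ℝ) / 3)) = 2 := by
  have hsq : Real.sqrt 2 ^ 2 = 2 := Real.sq_sqrt (by norm_num)
  have hu : 0 < Real.sqrt 2 - 1 := by
    have := Real.sqrt_nonneg 2
    nlinarith
  have ht : 0 < (Real.sqrt 2 - 1) ^ ((1 : ℝ) / 3) := Real.rpow_pos_of_pos hu _
  have ht3 : ((Real.sqrt 2 - 1) ^ ((1 : ℝ) / 3)) ^ 3 = Real.sqrt 2 - 1 := by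
    rw [← Real.rpow_natCast, ← Real.rpow_mul hu.le]
    norm_num
  generalize (Real.sqrt 2 - 1) ^ ((1 : ℝ) / 3) = t at *
  have ht6 : (t ^ 3) ^ 2 + 2 * t ^ 3 = 1 := by
    rw [ht3]
    linear_combination hsq
  field_simp
  linear_combination -ht6

/-- If `s` is the real root of `X ^ 3 + 3 X - 2`, then `4 - 6 s` is the maximum of
`32 (1 - 2x) x ^ 3 / (1 - (1 - 2x) ^ 4)` on `(0, 1/2)`, attained where
`1 - 2x = (s ^ 2 - s + 1) / 3`. -/
theorem isGreatest_image_of_cubic {s : ℝ} (hs : s ^ 3 + 3 * s = 2) :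
    IsGreatest ((fun x : ℝ => 32 * (1 - 2 * x) * x ^ 3 / (1 - (1 - 2 * x) ^ 4)) ''
      Set.Ioo (0 : ℝ) (1 / 2)) (4 - 6 * s) := by
  have hs0 : 0 < s := by nlinarith [sq_nonneg s]
  have hs1 : s < 1 := by nlinarith [sq_nonneg s]
  have hden : ∀ x ∈ Set.Ioo (0 : ℝ) (1 / 2), 0 < 1 - (1 - 2 * x) ^ 4 := fun x hx =>
    sub_pos.2 (pow_lt_one₀ (by linarith [hx.2]) (by linarith [hx.1]) (by norm_num))
  have key : ∀ x : ℝ, (4 - 6 * s) * (1 - (1 - 2 * x) ^ 4) - 32 * (1 - 2 * x) * x ^ 3 =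
      2 * x * (6 * s * (1 - 2 * x - (s ^ 2 - s + 1) / 3) ^ 2 *
        ((s ^ 2 + 2 * s + 4) / 3 - (1 - 2 * x))) := by
    intro x
    linear_combination 2 * x * (-6 * (1 - 2 * x) ^ 2 + 2 * s ^ 2 * (1 - 2 * x) - 2 -
      2 * s * (s ^ 3 - 2) / 9) * hs
  constructor
  · have hx : (1 - (s ^ 2 - s + 1) / 3) / 2 ∈ Set.Ioo (0 : ℝ) (1 / 2) := by
      constructor <;> nlinarith
    refine ⟨_, hx, ?_⟩
    have h := key ((1 - (s ^ 2 - s + 1) / 3) / 2)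
    rw [div_eq_iff (hden _ hx).ne']
    linear_combination -h
  · rintro _ ⟨x, hx, rfl⟩
    have hc : 0 < (s ^ 2 + 2 * s + 4) / 3 - (1 - 2 * x) := by nlinarith [hx.1]
    have hx0 := hx.1
    rw [div_le_iff₀ (hden x hx), ← sub_nonneg, key]
    positivity

theorem stmt15 :
    sSup ((fun x : ℝ => 32 * (1 - 2 * x) * x ^ 3 / (1 - (1 - 2 * x) ^ 4)) ''
        Set.Ioo (0 : ℝ) (1 / 2)) =
      4 - 6 / (Real.sqrt 2 - 1) ^ ((1 : ℝ) / 3) + 6 * (Real.sqrt 2 - 1) ^ ((1 : ℝ) / 3) := by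
  rw [(isGreatest_image_of_cubic cardano_sqrt_two_sub_one).csSup_eq]
  ring
end

section
/- The supremum of the function f(x) = 12·x²·(1−2x)² / (1 − 2x⁴) over x in the open interval (0, 1/2) equals 9·(√2 − 2) + 6·√(2·(√2 − 1)). -/
/-- At a root `v` of `2 v ^ 4 - 4 v + 1` in `(0, 1 / 2)`, the function attains its maximum on
`(0, 1 / 2)`, with value `6 v ^ 2 (1 - 2 v)`. -/
theorem isGreatest_image_of_critical {v : ℝ} (hv : 2 * v ^ 4 - 4 * v + 1 = 0)
    (hv0 : 0 < v) (hv1 : v < 1 / 2) :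
    IsGreatest ((fun x : ℝ => 12 * x ^ 2 * (1 - 2 * x) ^ 2 / (1 - 2 * x ^ 4)) ''
        Set.Ioo (0 : ℝ) (1 / 2)) (6 * v ^ 2 * (1 - 2 * v)) := by
  have hden : ∀ x ∈ Set.Ioo (0 : ℝ) (1 / 2), 0 < 1 - 2 * x ^ 4 := by
    rintro x ⟨h0, h1⟩
    have : x ^ 4 < (1 / 2) ^ 4 := by gcongr
    linarith
  refine ⟨⟨v, ⟨hv0, hv1⟩, ?_⟩, ?_⟩
  · have hd := hden v ⟨hv0, hv1⟩
    change _ / _ = _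
    rw [div_eq_iff hd.ne']
    linear_combination 6 * v ^ 2 * (1 - 2 * v) * hv
  · rintro _ ⟨x, hx, rfl⟩
    change _ / _ ≤ _
    rw [div_le_iff₀ (hden x hx)]
    obtain ⟨h0, h1⟩ := hx
    have hhi : v < 4 / 15 := by
      have : v ^ 4 < v * (1 / 2) ^ 3 := by
        rw [show v ^ 4 = v * v ^ 3 by ring]
        gcongr
      by_contra! h
      nlinarith
    have hfactor : 12 * x ^ 2 * (1 - 2 * x) ^ 2 - 6 * v ^ 2 * (1 - 2 * v) * (1 - 2 * x ^ 4) =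
        (x - v) ^ 2 * ((48 + 12 * v ^ 2 - 24 * v ^ 3) * x ^ 2
          + (-48 + 2 * v * (48 + 12 * v ^ 2 - 24 * v ^ 3)) * x - 6 * (1 - 2 * v)) := by
      linear_combination (18 * (1 - 2 * v) * x ^ 2 - 12 * v * (1 - 2 * v) * x) * hv
    set A := 48 + 12 * v ^ 2 - 24 * v ^ 3 with hA
    have hv3 : v ^ 3 < 1 / 8 := by
      calc v ^ 3 < (1 / 2) ^ 3 := by gcongr
        _ = 1 / 8 := by norm_num
    have hA0 : 0 ≤ A := by nlinarith
    have hright : A / 4 + (-48 + 2 * v * A) / 2 - 6 * (1 - 2 * v) ≤ 0 := by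
      rw [show A / 4 + (-48 + 2 * v * A) / 2 - 6 * (1 - 2 * v) =
        -6 + 12 * v + 3 * v ^ 2 + 6 * v ^ 3 by rw [hA]; linear_combination -12 * hv]
      nlinarith
    have hquad : A * x ^ 2 + (-48 + 2 * v * A) * x - 6 * (1 - 2 * v) ≤ 0 := by
      have hconvex : 0 ≤ A * (x * (1 / 2 - x)) :=
        mul_nonneg hA0 (mul_nonneg h0.le (by linarith))
      have h3 := mul_nonneg h0.le (neg_nonneg.2 hright)
      have h4 : 0 ≤ (1 - 2 * x) * (1 - 2 * v) := mul_nonneg (by linarith) (by linarith)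
      linarith
    linarith [mul_nonneg (sq_nonneg (x - v)) (neg_nonneg.2 hquad)]

theorem stmt16 :
    sSup ((fun x : ℝ => 12 * x ^ 2 * (1 - 2 * x) ^ 2 / (1 - 2 * x ^ 4)) ''
        Set.Ioo (0 : ℝ) (1 / 2)) =
      9 * (Real.sqrt 2 - 2) + 6 * Real.sqrt (2 * (Real.sqrt 2 - 1)) := by
  have hs2 : √2 ^ 2 = (2 : ℝ) := Real.sq_sqrt (by norm_num)
  have hs0 : (0 : ℝ) ≤ √2 := Real.sqrt_nonneg 2
  have hs_lo : (7 / 5 : ℝ) < √2 := Real.lt_sqrt_of_sq_lt (by norm_num)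
  have hs_hi : √2 < (3 / 2 : ℝ) := (Real.sqrt_lt' (by norm_num)).2 (by norm_num)
  rw [Real.sqrt_mul (by norm_num : (0 : ℝ) ≤ 2)]
  have hr2 : √(√2 - 1) ^ 2 = √2 - 1 := Real.sq_sqrt (by linarith)
  have hr0 : (0 : ℝ) ≤ √(√2 - 1) := Real.sqrt_nonneg _
  generalize √(√2 - 1) = r at *
  generalize √2 = s at *
  have hr_lo : 3 / 5 < r := by nlinarith
  have hr_hi : r < 1 := by nlinarith
  have h2 : (s * (1 - r) / 2) ^ 2 = (s - 2 * r) / 2 := by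
    linear_combination (1 - r) ^ 2 / 4 * hs2 + hr2 / 2
  have hv : 2 * (s * (1 - r) / 2) ^ 4 - 4 * (s * (1 - r) / 2) + 1 = 0 := by
    linear_combination 2 * ((s * (1 - r) / 2) ^ 2 + (s - 2 * r) / 2) * h2 + 2 * hr2 + hs2 / 2
  rw [(isGreatest_image_of_critical hv (by nlinarith) (by nlinarith)).csSup_eq]
  linear_combination 6 * (1 - 2 * (s * (1 - r) / 2)) * h2 - 6 * s * hr2 +
    (3 * r - 9) * hs2
end

section
/- The supremum of the function f(x) = 24·(1−2x)·x³ / (1 − (1−2x)⁴) over x in the open interval (0, 1/2) equals (3/2)·(2 − 3/(√2 − 1)^{1/3} + 3·(√2 − 1)^{1/3}). -/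
/-- The number `u = t⁻¹ - t` with `t = (√2 - 1)^(1/3)` is the real root of `u ^ 3 + 3 * u = 2`. -/
lemma cube_add_three_mul_inv_sub_self {t : ℝ} (ht : 0 < t) (h : t ^ 3 = √2 - 1) :
    (t⁻¹ - t) ^ 3 + 3 * (t⁻¹ - t) = 2 := by
  have hs : √2 ^ 2 = 2 := Real.sq_sqrt (by norm_num)
  have hinv : t⁻¹ ^ 3 = √2 + 1 := by
    rw [inv_pow, h]
    refine inv_eq_of_mul_eq_one_right ?_
    linear_combination hs
  have ht' : t⁻¹ * t = 1 := inv_mul_cancel₀ ht.ne'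
  linear_combination hinv - h + (-3 * t⁻¹ + 3 * t) * ht'

/-- In the variable `y = 1 - 2 * x`, the function is `3 * y * (1 - y) ^ 2 / ((1 + y) * (1 + y ^ 2))`. -/
lemma div_one_sub_pow_four_eq {x : ℝ} (hx : x ∈ Set.Ioo (0 : ℝ) (1 / 2)) :
    24 * (1 - 2 * x) * x ^ 3 / (1 - (1 - 2 * x) ^ 4) =
      3 * ((1 - 2 * x) * (1 - (1 - 2 * x)) ^ 2) /
        ((1 + (1 - 2 * x)) * (1 + (1 - 2 * x) ^ 2)) := by
  obtain ⟨h0, h1⟩ := hx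
  have hD : 0 < (1 + (1 - 2 * x)) * (1 + (1 - 2 * x) ^ 2) :=
    mul_pos (by linarith) (by positivity)
  have hE : 1 - (1 - 2 * x) ^ 4 = 2 * x * ((1 + (1 - 2 * x)) * (1 + (1 - 2 * x) ^ 2)) := by ring
  rw [hE, div_eq_div_iff (by positivity) hD.ne']
  ring

/-- Tangency identity: the cubic certifying the maximum has a double root at
`(u ^ 2 - u + 1) / 3`. -/
lemma tangency_identity {u : ℝ} (hu : u ^ 3 + 3 * u = 2) (y : ℝ) :
    (1 - 3 * u / 2) * ((1 + y) * (1 + y ^ 2)) - y * (1 - y) ^ 2 =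
      (y - (u ^ 2 - u + 1) / 3) ^ 2 * (1 + u / 2 + u ^ 2 - 3 * u / 2 * y) := by
  linear_combination
    (-u ^ 3 / 9 + u ^ 2 / 6 - 4 / 9 + (u ^ 2 / 6 + u / 3 - 1 / 3) * y - y ^ 2) * hu

theorem stmt17 :
    sSup ((fun x : ℝ => 24 * (1 - 2 * x) * x ^ 3 / (1 - (1 - 2 * x) ^ 4)) ''
        Set.Ioo (0 : ℝ) (1 / 2)) =
      (3 / 2) * (2 - 3 / (Real.sqrt 2 - 1) ^ ((1 : ℝ) / 3)
        + 3 * (Real.sqrt 2 - 1) ^ ((1 : ℝ) / 3)) := by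
  have hpos : 0 < √2 - 1 := sub_pos.2 (Real.lt_sqrt_of_sq_lt (by norm_num))
  set t := (√2 - 1) ^ ((1 : ℝ) / 3) with ht_def
  have ht : 0 < t := Real.rpow_pos_of_pos hpos _
  have ht3 : t ^ 3 = √2 - 1 := by
    rw [ht_def, ← Real.rpow_natCast, ← Real.rpow_mul hpos.le]
    norm_num
  have hu := cube_add_three_mul_inv_sub_self ht ht3
  have hval : 3 / 2 * (2 - 3 / t + 3 * t) = 3 * (1 - 3 * (t⁻¹ - t) / 2) := by
    rw [div_eq_mul_inv 3 t]
    ring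
  rw [hval]
  generalize t⁻¹ - t = u at hu
  have hu0 : 0 < u := by
    by_contra! h
    nlinarith [mul_nonneg (neg_nonneg.2 h) (sq_nonneg u)]
  have hu1 : u < 1 := by
    by_contra! h
    nlinarith [mul_nonneg hu0.le (sq_nonneg u)]
  refine IsGreatest.csSup_eq ⟨⟨(1 - (u ^ 2 - u + 1) / 3) / 2, ?_, ?_⟩, ?_⟩
  · constructor <;> nlinarith
  · have hmem : (1 - (u ^ 2 - u + 1) / 3) / 2 ∈ Set.Ioo (0 : ℝ) (1 / 2) := by
      constructor <;> nlinarith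
    have key := tangency_identity hu ((u ^ 2 - u + 1) / 3)
    have hy : 1 - 2 * ((1 - (u ^ 2 - u + 1) / 3) / 2) = (u ^ 2 - u + 1) / 3 := by ring
    have hy0 : 0 < (u ^ 2 - u + 1) / 3 := by nlinarith
    beta_reduce
    rw [div_one_sub_pow_four_eq hmem, hy, div_eq_iff (by positivity)]
    linear_combination -3 * key
  · rintro _ ⟨x, hx, rfl⟩
    beta_reduce
    rw [div_one_sub_pow_four_eq hx]
    obtain ⟨h0, h1⟩ := hx
    have key := tangency_identity hu (1 - 2 * x)
    have hlin : 0 ≤ 1 + u / 2 + u ^ 2 - 3 * u / 2 * (1 - 2 * x) := by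
      nlinarith [mul_pos hu0 h0]
    rw [div_le_iff₀ (mul_pos (by linarith) (by positivity))]
    linarith [mul_nonneg (sq_nonneg (1 - 2 * x - (u ^ 2 - u + 1) / 3)) hlin]
end

section
/- The supremum of the function f(x) = (x⁴/8 + x³·(1−x)) / (1 − (1−x)⁴) over x in the half-open interval (0, 1] equals (8 − 3^{7/3} + 3^{5/3}) / 8. -/
theorem one_sub_one_sub_pow_four_pos {x : ℝ} (hx : x ∈ Set.Ioc (0 : ℝ) 1) :
    0 < 1 - (1 - x) ^ 4 :=
  sub_pos.2 (pow_lt_one₀ (by linarith [hx.2]) (by linarith [hx.1]) (by norm_num))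

/-- With `t` the cube root of `3`, the gap between the claimed maximum and the numerator has a
double root at the maximiser. -/
theorem gap_eq_sq_mul {t : ℝ} (ht : t ^ 3 = 3) (x : ℝ) :
    (8 - 9 * t + 3 * t ^ 2) / 8 * (1 - (1 - x) ^ 4) - (x ^ 4 / 8 + x ^ 3 * (1 - x)) =
      x / 8 * (x - (7 + t - 2 * t ^ 2) / 5) ^ 2 *
        ((-1 + 9 * t - 3 * t ^ 2) * x + (-4 - 4 * t + 8 * t ^ 2)) := by
  have h4 : t ^ 4 = 3 * t := by linear_combination t * ht
  have h5 : t ^ 5 = 3 * t ^ 2 := by linear_combination t ^ 2 * ht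
  have h6 : t ^ 6 = 9 := by linear_combination (t ^ 3 + 3) * ht
  ring_nf
  simp only [ht, h4, h5, h6]
  ring

theorem stmt18 :
    sSup ((fun x : ℝ => (x ^ 4 / 8 + x ^ 3 * (1 - x)) / (1 - (1 - x) ^ 4)) ''
        Set.Ioc (0 : ℝ) 1) =
      (8 - (3 : ℝ) ^ ((7 : ℝ) / 3) + (3 : ℝ) ^ ((5 : ℝ) / 3)) / 8 := by
  obtain ⟨t, ht_def⟩ : ∃ t : ℝ, t = (3 : ℝ) ^ ((1 : ℝ) / 3) := ⟨_, rfl⟩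
  have ht0 : 0 < t := ht_def ▸ by positivity
  have pow_t (n : ℕ) : t ^ n = (3 : ℝ) ^ ((n : ℝ) / 3) := by
    rw [ht_def, ← Real.rpow_mul_natCast (by norm_num)]
    congr 1
    ring
  have ht : t ^ 3 = 3 := by rw [pow_t]; norm_num
  have h7 : (3 : ℝ) ^ ((7 : ℝ) / 3) = 9 * t := by
    have h := pow_t 7
    push_cast at h
    rw [← h]
    linear_combination (t ^ 4 + 3 * t) * ht
  have h5 : (3 : ℝ) ^ ((5 : ℝ) / 3) = 3 * t ^ 2 := by
    have h := pow_t 5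
    push_cast at h
    rw [← h]
    linear_combination t ^ 2 * ht
  have hlo : 1.44 < t := lt_of_pow_lt_pow_left₀ 3 ht0.le (by rw [ht]; norm_num)
  have hhi : t < 1.45 := lt_of_pow_lt_pow_left₀ 3 (by norm_num) (by rw [ht]; norm_num)
  rw [h7, h5]
  have hmem : (7 + t - 2 * t ^ 2) / 5 ∈ Set.Ioc (0 : ℝ) 1 := by constructor <;> nlinarith
  refine IsGreatest.csSup_eq ⟨⟨(7 + t - 2 * t ^ 2) / 5, hmem, ?_⟩, ?_⟩
  · refine (div_eq_iff (one_sub_one_sub_pow_four_pos hmem).ne').2 ?_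
    have h := gap_eq_sq_mul ht ((7 + t - 2 * t ^ 2) / 5)
    rw [sub_self] at h
    linarith
  · rintro _ ⟨x, hx, rfl⟩
    refine (div_le_iff₀ (one_sub_one_sub_pow_four_pos hx)).2 (sub_nonneg.1 ?_)
    rw [gap_eq_sq_mul ht]
    have hA : 0 ≤ -1 + 9 * t - 3 * t ^ 2 := by nlinarith
    have hB : 0 ≤ -4 - 4 * t + 8 * t ^ 2 := by nlinarith
    have hx0 := hx.1.le
    positivity
end

section
/- The supremum of the function f(x) = ((8/5)·x·(1−x)³ + (8/315)·(1−x)⁴) / (1 − x⁴) over x in the half-open interval [0, 1) equals (4/105)·(61^{2/3}·((√7690 − 63)^{1/3} − (63 + √7690)^{1/3}) + 42). -/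
/-- The critical point of the objective function is a root of this cubic. -/
lemma exists_critical_point :
    ∃ r : ℝ, 0 < r ∧ r < 1 / 4 ∧ 59 - 189 * r - 189 * r ^ 2 - 185 * r ^ 3 = 0 := by
  have hc : ContinuousOn (fun r : ℝ => 59 - 189 * r - 189 * r ^ 2 - 185 * r ^ 3)
      (Set.Icc 0 (1 / 4)) := by fun_prop
  obtain ⟨r, hr, h⟩ := intermediate_value_Ioo' (by norm_num) hc
    (show (0 : ℝ) ∈ Set.Ioo _ _ by constructor <;> norm_num)
  exact ⟨r, hr.1, hr.2, h⟩

/-- The Cardano expression is a root of the depressed cubic `y ^ 3 + 11163 * y + 468846`. -/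
lemma cardano_root :
    ((61 : ℝ) ^ ((2 : ℝ) / 3) *
      ((Real.sqrt 7690 - 63) ^ ((1 : ℝ) / 3) - (63 + Real.sqrt 7690) ^ ((1 : ℝ) / 3))) ^ 3 +
    11163 * ((61 : ℝ) ^ ((2 : ℝ) / 3) *
      ((Real.sqrt 7690 - 63) ^ ((1 : ℝ) / 3) - (63 + Real.sqrt 7690) ^ ((1 : ℝ) / 3))) +
    468846 = 0 := by
  have hs : Real.sqrt 7690 ^ 2 = 7690 := Real.sq_sqrt (by norm_num)
  have hlt : 63 < Real.sqrt 7690 := Real.lt_sqrt_of_sq_lt (by norm_num)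
  have hu : (0 : ℝ) ≤ Real.sqrt 7690 - 63 := by linarith
  have hv : (0 : ℝ) ≤ 63 + Real.sqrt 7690 := by linarith
  have cube (z : ℝ) (hz : 0 ≤ z) : (z ^ ((1 : ℝ) / 3)) ^ 3 = z := by
    rw [← Real.rpow_natCast, ← Real.rpow_mul hz]
    norm_num
  have hg : ((61 : ℝ) ^ ((2 : ℝ) / 3)) ^ 3 = 3721 := by
    rw [← Real.rpow_natCast, ← Real.rpow_mul (by norm_num)]
    norm_num
  have hab : (Real.sqrt 7690 - 63) ^ ((1 : ℝ) / 3) * (63 + Real.sqrt 7690) ^ ((1 : ℝ) / 3) =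
      (61 : ℝ) ^ ((2 : ℝ) / 3) := by
    rw [← Real.mul_rpow hu hv,
      show (Real.sqrt 7690 - 63) * (63 + Real.sqrt 7690) = (61 : ℝ) ^ (2 : ℝ) by
        norm_num
        linarith,
      ← Real.rpow_mul (by norm_num)]
    norm_num
  have ha := cube _ hu
  have hb := cube _ hv
  generalize (Real.sqrt 7690 - 63) ^ ((1 : ℝ) / 3) = a at *
  generalize (63 + Real.sqrt 7690) ^ ((1 : ℝ) / 3) = b at *
  generalize (61 : ℝ) ^ ((2 : ℝ) / 3) = g at *
  linear_combination (a - b) ^ 3 * hg + 3721 * (ha - hb) - 11163 * (a - b) * hab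

/-- A monotone depressed cubic has at most one real root. -/
lemma depressed_cubic_root_unique {p q y z : ℝ} (hp : 0 < p)
    (hy : y ^ 3 + p * y + q = 0) (hz : z ^ 3 + p * z + q = 0) : y = z := by
  have h : (y - z) * (y ^ 2 + y * z + z ^ 2 + p) = 0 := by linear_combination hy - hz
  rcases mul_eq_zero.mp h with h | h
  · linarith
  · nlinarith [sq_nonneg (y + z), sq_nonneg y, sq_nonneg z]

/-- The objective function after cancelling the common factor `1 - x`. -/
lemma objective_eq {x : ℝ} (h0 : 0 ≤ x) (h1 : x < 1) :
    ((8 / 5) * x * (1 - x) ^ 3 + (8 / 315) * (1 - x) ^ 4) / (1 - x ^ 4) =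
      8 / 315 * ((1 - x) ^ 2 * (1 + 62 * x) / (1 + x + x ^ 2 + x ^ 3)) := by
  have hx : 1 - x ≠ 0 := by linarith
  have hD : 1 + x + x ^ 2 + x ^ 3 ≠ 0 := by positivity
  rw [show 1 - x ^ 4 = (1 - x) * (1 + x + x ^ 2 + x ^ 3) by ring]
  field_simp
  ring

theorem stmt19 :
    sSup ((fun x : ℝ =>
        ((8 / 5) * x * (1 - x) ^ 3 + (8 / 315) * (1 - x) ^ 4) / (1 - x ^ 4)) ''
        Set.Ico (0 : ℝ) 1) =
      (4 / 105) * ((61 : ℝ) ^ ((2 : ℝ) / 3) *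
        ((Real.sqrt 7690 - 63) ^ ((1 : ℝ) / 3) - (63 + Real.sqrt 7690) ^ ((1 : ℝ) / 3))
        + 42) := by
  obtain ⟨r, hr0, hr1, hr⟩ := exists_critical_point
  have hD : 0 < 1 + r + r ^ 2 + r ^ 3 := by positivity
  have hN : 0 ≤ (1 - r) ^ 2 * (1 + 62 * r) := by positivity
  have hroot : (2 / 3 * ((1 - r) ^ 2 * (1 + 62 * r) / (1 + r + r ^ 2 + r ^ 3)) - 42) ^ 3 +
      11163 * (2 / 3 * ((1 - r) ^ 2 * (1 + 62 * r) / (1 + r + r ^ 2 + r ^ 3)) - 42) +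
      468846 = 0 := by
    rw [show 2 / 3 * ((1 - r) ^ 2 * (1 + 62 * r) / (1 + r + r ^ 2 + r ^ 3)) - 42 =
      (2 / 3 * ((1 - r) ^ 2 * (1 + 62 * r)) - 42 * (1 + r + r ^ 2 + r ^ 3)) /
        (1 + r + r ^ 2 + r ^ 3) by field_simp]
    generalize hd : 1 + r + r ^ 2 + r ^ 3 = d at *
    have hd0 := hD.ne'
    rw [div_pow, ← mul_div_assoc, div_add_div _ _ (by positivity) hd0,
      div_add' _ _ _ (by positivity), div_eq_zero_iff]
    left
    subst hd
    linear_combination (1 + r + r ^ 2 + r ^ 3) *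
      (-28910 / 27 + 12650 / 3 * r - 2108 / 3 * r ^ 2 + 183568 / 27 * r ^ 3 +
        454 / 3 * r ^ 4 + 7526 / 3 * r ^ 5 - 67340 / 27 * r ^ 6) * hr
  rw [← depressed_cubic_root_unique (by norm_num) hroot cardano_root]
  apply IsGreatest.csSup_eq
  constructor
  · refine ⟨r, ⟨hr0.le, by linarith⟩, ?_⟩
    simp only
    rw [objective_eq hr0.le (by linarith)]
    ring
  · rintro _ ⟨x, ⟨hx0, hx1⟩, rfl⟩
    simp only
    rw [objective_eq hx0 hx1]
    have hDx : 0 < 1 + x + x ^ 2 + x ^ 3 := by positivity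
    have key : (1 - x) ^ 2 * (1 + 62 * x) / (1 + x + x ^ 2 + x ^ 3) ≤
        (1 - r) ^ 2 * (1 + 62 * r) / (1 + r + r ^ 2 + r ^ 3) := by
      rw [div_le_div_iff₀ hDx hD]
      have hT : 0 ≤ (1 - r) ^ 2 * (1 + 62 * r) * (1 + (x + 2 * r)) +
          (1 + r + r ^ 2 + r ^ 3) * (123 - 62 * (x + 2 * r)) :=
        add_nonneg (mul_nonneg hN (by linarith)) (mul_nonneg hD.le (by linarith))
      have h := mul_nonneg (sq_nonneg (x - r)) hT
      refine sub_nonneg.mp (h.trans_eq ?_)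
      linear_combination (x - r) * (1 - r) * hr
    linarith
end
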